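/- Let R be a local Gorenstein ring with infinite residue field. Let I be an R-ideal of grade g, satisfying condition G_ℓ, where ℓ is the analytic spread of I, and unmixed locally in codimension ℓ. Suppose I is weakly (ℓ−1)-residually S_2 and that Ext^{g+j}_R(R/I^j, R)_𝔭 = 0 whenever 𝔭 ∈ V(I) with dim R_𝔭 ≤ ℓ and 1 ≤ j ≤ ℓ−g. Then the reduction number of I is either zero or at least ℓ−g+1. -/

import Mathlib

noncomputable section

open IsLocalRing CategoryTheory

universe u

/-- The Krull dimension of the localization `R_p`, i.e. the height of the prime `p`. -/
noncomputable def dimAt {R : Type*} [CommRing R] (p : Ideal R) (hp : p.IsPrime) : WithBot ℕ∞ :=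
  haveI := hp
  ringKrullDim (Localization.AtPrime p)

/-- The minimal number of generators of a module, as an extended natural number. -/
noncomputable def mu (R M : Type*) [CommRing R] [AddCommGroup M] [Module R M] : ℕ∞ :=
  sInf {n : ℕ∞ | ∃ s : Finset M, (s.card : ℕ∞) = n ∧ Submodule.span R (s : Set M) = ⊤}

/-- The grade of an ideal: the supremum of the lengths of regular sequences contained in it. -/
noncomputable def idealGrade {R : Type*} [CommRing R] (I : Ideal R) : ℕ∞ :=
  sSup {n : ℕ∞ | ∃ l : List R, (∀ x ∈ l, x ∈ I) ∧ RingTheory.Sequence.IsRegular R l ∧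
    (l.length : ℕ∞) = n}

/-- The height of an ideal: the infimum of the heights of the primes containing it. -/
noncomputable def idealHeight {R : Type*} [CommRing R] (K : Ideal R) : WithBot ℕ∞ :=
  sInf {d | ∃ (p : Ideal R) (hp : p.IsPrime), K ≤ p ∧ d = dimAt p hp}

/-- A local ring is Cohen--Macaulay if its depth (the grade of the maximal ideal)
equals its Krull dimension. -/
def IsCohenMacaulayLocalRing (R : Type*) [CommRing R] [IsLocalRing R] : Prop :=
  (idealGrade (maximalIdeal R) : WithBot ℕ∞) = ringKrullDim R

/-- A local ring is Gorenstein if it is Cohen--Macaulay and some maximal regular sequence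
(i.e. a regular sequence of length `dim R` inside the maximal ideal) generates an
irreducible ideal. -/
def IsGorensteinLocalRing (R : Type*) [CommRing R] [IsLocalRing R] : Prop :=
  IsCohenMacaulayLocalRing R ∧
  ∃ l : List R, (∀ x ∈ l, x ∈ maximalIdeal R) ∧ RingTheory.Sequence.IsRegular R l ∧
    ((l.length : ℕ∞) : WithBot ℕ∞) = ringKrullDim R ∧
    ∀ J K : Ideal R, J ⊓ K = Ideal.ofList l → (J = Ideal.ofList l ∨ K = Ideal.ofList l)

/-- Serre's condition `S_2` for a ring: `depth A_p ≥ min (2, dim A_p)` for all primes `p`. -/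
def SerreS2 (A : Type*) [CommRing A] : Prop :=
  ∀ (p : Ideal A) (hp : p.IsPrime),
    haveI := hp
    min (2 : WithBot ℕ∞) (ringKrullDim (Localization.AtPrime p)) ≤
      (idealGrade (maximalIdeal (Localization.AtPrime p)) : WithBot ℕ∞)

/-- Condition `G_s` for an ideal: `μ(I_p) ≤ dim R_p` for every prime `p ⊇ I`
with `dim R_p ≤ s - 1`. -/
def IdealGs {R : Type*} [CommRing R] (I : Ideal R) (s : ℕ) : Prop :=
  ∀ (p : Ideal R) (hp : p.IsPrime), I ≤ p → dimAt p hp < (s : WithBot ℕ∞) →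
    haveI := hp
    ((mu (Localization.AtPrime p)
        (I.map (algebraMap R (Localization.AtPrime p))) : ℕ∞) : WithBot ℕ∞) ≤ dimAt p hp

/-- An `s`-residual intersection of `I`: a proper ideal `K = 𝔞 : I` where `𝔞 ⊆ I` is
generated by at most `s` elements and `height K ≥ s`. -/
def IsResidualIntersection {R : Type*} [CommRing R] (I 𝔞 : Ideal R) (s : ℕ) : Prop :=
  𝔞 ≤ I ∧ (∃ f : Fin s → R, Ideal.span (Set.range f) = 𝔞) ∧
    Submodule.colon 𝔞 I ≠ ⊤ ∧ (s : WithBot ℕ∞) ≤ idealHeight (Submodule.colon 𝔞 I)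

/-- A geometric `s`-residual intersection: an `s`-residual intersection `K = 𝔞 : I`
with moreover `height (I + K) ≥ s + 1`. -/
def IsGeometricResidualIntersection {R : Type*} [CommRing R] (I 𝔞 : Ideal R) (s : ℕ) : Prop :=
  IsResidualIntersection I 𝔞 s ∧
    ((s + 1 : ℕ) : WithBot ℕ∞) ≤ idealHeight (I ⊔ Submodule.colon 𝔞 I)

/-- `I` (of grade `g`) is weakly `(s-1)`-residually `S_2`: for every `g ≤ i ≤ s - 1` and
every geometric `i`-residual intersection `K = 𝔞 : I` of `I`, the ring `R/K`
satisfies Serre's condition `S_2`. -/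
def WeaklyResiduallyS2Lt {R : Type*} [CommRing R] (I : Ideal R) (g s : ℕ) : Prop :=
  ∀ i : ℕ, g ≤ i → i < s → ∀ 𝔞 : Ideal R, IsGeometricResidualIntersection I 𝔞 i →
    SerreS2 (R ⧸ Submodule.colon 𝔞 I)

/-- `J` is a reduction of `I`: `J ⊆ I` and `I^(r+1) = J I^r` for some `r`. -/
def IsReduction {R : Type*} [CommRing R] (J I : Ideal R) : Prop :=
  J ≤ I ∧ ∃ r : ℕ, I ^ (r + 1) = J * I ^ r

/-- A minimal reduction is a reduction which is minimal with respect to containment. -/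
def IsMinimalReduction {R : Type*} [CommRing R] (J I : Ideal R) : Prop :=
  IsReduction J I ∧ ∀ J' : Ideal R, J' ≤ J → IsReduction J' I → J' = J

/-- The reduction number of `I` with respect to a reduction `J`. -/
noncomputable def reductionNumberWrt {R : Type*} [CommRing R] (J I : Ideal R) : ℕ :=
  sInf {r : ℕ | I ^ (r + 1) = J * I ^ r}

/-- The reduction number of `I`: the minimum of the reduction numbers of `I` with
respect to its minimal reductions. -/
noncomputable def reductionNumber {R : Type*} [CommRing R] (I : Ideal R) : ℕ :=
  sInf {n : ℕ | ∃ J : Ideal R, IsMinimalReduction J I ∧ reductionNumberWrt J I = n}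

/-- The analytic spread of `I`: the Krull dimension of the fiber cone
`R[It] ⊗ R/m` of `I`. -/
noncomputable def analyticSpread (R : Type*) [CommRing R] [IsLocalRing R] (I : Ideal R) :
    WithBot ℕ∞ :=
  ringKrullDim ((reesAlgebra I) ⧸ Ideal.map (algebraMap R (reesAlgebra I)) (maximalIdeal R))

/-- The localization at `p` of `Ext_R^n(M, N)` vanishes. -/
def ExtVanishesAt {R : Type u} [CommRing R] (M N : Type u) [AddCommGroup M] [Module R M]
    [AddCommGroup N] [Module R N] (n : ℕ) (p : Ideal R) (hp : p.IsPrime) : Prop :=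
  haveI := hp
  Subsingleton (LocalizedModule p.primeCompl
    ↥(((Ext R (ModuleCat.{u} R) n).obj (Opposite.op (ModuleCat.of R M))).obj
        (ModuleCat.of R N)))

/-! ### Associated primes of `R ⧸ K` and elementwise localization -/

/-- `P` is an associated prime of `R ⧸ K`. -/
def IsAssocTo {R : Type*} [CommRing R] (K P : Ideal R) : Prop :=
  P.IsPrime ∧ ∃ x, ∀ r, r ∈ P ↔ r * x ∈ K

namespace IsAssocTo

variable {R : Type*} [CommRing R] {K P : Ideal R}

lemma isPrime (h : IsAssocTo K P) : P.IsPrime := h.1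

lemma le (h : IsAssocTo K P) : K ≤ P := by
  obtain ⟨_, x, hx⟩ := h
  exact fun r hr => (hx r).2 (K.mul_mem_right x hr)

lemma notMem_of_regular (h : IsAssocTo K P) {a : R} (ha : ∀ x, a * x ∈ K → x ∈ K) : a ∉ P := by
  obtain ⟨hP, x, hx⟩ := h
  intro h
  exact hP.one_notMem ((hx 1).2 (by simpa using ha x ((hx a).1 h)))

end IsAssocTo

section Elementwise

variable {R : Type*} [CommRing R] [IsNoetherianRing R]

lemma setOf_isAssocTo_eq (K : Ideal R) : {P | IsAssocTo K P} = associatedPrimes R (R ⧸ K) := by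
  ext P
  simp only [Set.mem_ofPred_eq, IsAssocTo, associatedPrimes, isAssociatedPrime_iff]
  refine and_congr_right fun _ => ⟨?_, ?_⟩
  · rintro ⟨x, hx⟩
    refine ⟨Ideal.Quotient.mk K x, ?_⟩
    ext r
    rw [hx]
    simp [Submodule.mem_colon_singleton, Algebra.smul_def, ← map_mul,
      Ideal.Quotient.eq_zero_iff_mem]
  · rintro ⟨x, hx⟩
    obtain ⟨x, rfl⟩ := Ideal.Quotient.mk_surjective x
    refine ⟨x, fun r => ?_⟩
    rw [hx]
    simp [Submodule.mem_colon_singleton, Algebra.smul_def, ← map_mul,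
      Ideal.Quotient.eq_zero_iff_mem]

lemma finite_setOf_isAssocTo (K : Ideal R) : {P | IsAssocTo K P}.Finite := by
  rw [setOf_isAssocTo_eq]
  exact associatedPrimes.finite R (R ⧸ K)

lemma exists_isAssocTo_le {K Q : Ideal R} (hQ : Q.IsPrime) {x : R}
    (h : ∀ r, r * x ∈ K → r ∈ Q) :
    ∃ P, IsAssocTo K P ∧ (∀ r, r * x ∈ K → r ∈ P) ∧ P ≤ Q := by
  let S : Set (Ideal R) := {P | P ≤ Q ∧ ∃ y, ∀ r, r ∈ P ↔ r * (y * x) ∈ K}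
  have mk (y : R) : ∃ P : Ideal R, ∀ r, r ∈ P ↔ r * y ∈ K :=
    ⟨Submodule.comap (LinearMap.mulRight R y) K, fun r => by simp⟩
  have hne : S.Nonempty := by
    obtain ⟨P, hP⟩ := mk x
    exact ⟨P, fun r hr => h r ((hP r).1 hr), 1, by simpa using hP⟩
  obtain ⟨P, ⟨hPQ, y, hy⟩, hmax⟩ := set_has_maximal_iff_noetherian.2 ‹_› S hne
  refine ⟨P, ⟨⟨fun h => hQ.ne_top (top_le_iff.1 (h ▸ hPQ)), ?_⟩, y * x, hy⟩, ?_, hPQ⟩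
  · intro r s hrs
    by_contra! hcon
    obtain ⟨hr, hs⟩ := hcon
    obtain ⟨P', hP'⟩ := mk (r * (y * x))
    have hlt : P < P' := by
      refine lt_of_le_of_ne (fun t ht => (hP' t).2 ?_) ?_
      · have := K.mul_mem_left r ((hy t).1 ht)
        convert this using 1; ring
      · rintro rfl
        exact hs ((hP' s).2 (by convert (hy _).1 hrs using 1; ring))
    have : ¬ P' ≤ Q := fun hle => hmax P' ⟨hle, r * y, fun t => by rw [hP', mul_assoc]⟩ hlt
    obtain ⟨w, hw, hwQ⟩ := SetLike.not_le_iff_exists.1 this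
    obtain ⟨P'', hP''⟩ := mk (w * (y * x))
    have hlt : P < P'' := by
      refine lt_of_le_of_ne (fun t ht => (hP'' t).2 ?_) ?_
      · have := K.mul_mem_left w ((hy t).1 ht)
        convert this using 1; ring
      · rintro rfl
        exact hr ((hP'' r).2 (by convert (hP' _).1 hw using 1; ring))
    refine hmax P'' ⟨fun t ht => ?_, w * y, fun t => by rw [hP'', mul_assoc]⟩ hlt
    have h1 : t * w ∈ P := (hy _).2 (by convert (hP'' _).1 ht using 1; ring)
    exact (hQ.mem_or_mem (hPQ h1)).resolve_right hwQ
  · intro r hr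
    refine (hy r).2 ?_
    convert K.mul_mem_left y hr using 1; ring

/-- If `x` lies in `K` locally at all associated primes of `K` inside `Q`, it does at `Q`. -/
lemma exists_mul_mem_of_isAssocTo {K Q : Ideal R} (hQ : Q.IsPrime) {x : R}
    (h : ∀ P, IsAssocTo K P → P ≤ Q → ∃ v ∉ P, v * x ∈ K) : ∃ v ∉ Q, v * x ∈ K := by
  by_contra! hcon
  obtain ⟨P, hP, hPx, hPQ⟩ := exists_isAssocTo_le (K := K) hQ (x := x)
    (fun r hr => by_contra fun hrQ => hcon r hrQ hr)
  obtain ⟨v, hv, hvx⟩ := h P hP hPQ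
  exact hv (hPx v hvx)

lemma mem_of_isAssocTo {K : Ideal R} {x : R}
    (h : ∀ P, IsAssocTo K P → ∃ v ∉ P, v * x ∈ K) : x ∈ K := by
  by_contra hx
  let L : Ideal R := Submodule.comap (LinearMap.mulRight R x) K
  have hL : L ≠ ⊤ := fun hL => hx (by simpa [L] using (Ideal.eq_top_iff_one _).1 hL)
  obtain ⟨Q, hQ, hLQ⟩ := Ideal.exists_le_maximal L hL
  obtain ⟨v, hv, hvx⟩ := exists_mul_mem_of_isAssocTo (K := K) hQ.isPrime (x := x)
    fun P hP _ => h P hP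
  exact hv (hLQ (by simpa [L] using hvx))

lemma regular_of_notMem_isAssocTo {K : Ideal R} {a : R} (h : ∀ P, IsAssocTo K P → a ∉ P)
    (x : R) (hx : a * x ∈ K) : x ∈ K :=
  mem_of_isAssocTo fun P hP => ⟨a, h P hP, hx⟩

lemma exists_isAssocTo_le_of_le {K Q : Ideal R} (hQ : Q.IsPrime) (h : K ≤ Q) :
    ∃ P, IsAssocTo K P ∧ P ≤ Q := by
  obtain ⟨P, hP, _, hPQ⟩ := exists_isAssocTo_le (K := K) hQ (x := 1)
    (fun r hr => h (by simpa using hr))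
  exact ⟨P, hP, hPQ⟩

lemma isAssocTo_of_minimal {K Q : Ideal R} (hQ : Q.IsPrime) (h : K ≤ Q)
    (hmin : ∀ P : Ideal R, P.IsPrime → K ≤ P → P ≤ Q → P = Q) : IsAssocTo K Q := by
  obtain ⟨P, hP, hPQ⟩ := exists_isAssocTo_le_of_le hQ h
  rwa [← hmin P hP.isPrime hP.le hPQ]

/-- A uniform multiplier for membership of a finitely generated ideal. -/
lemma exists_uniform {Q I K : Ideal R} (hQ : Q.IsPrime) (h : ∀ x ∈ I, ∃ v ∉ Q, v * x ∈ K) :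
    ∃ v ∉ Q, ∀ x ∈ I, v * x ∈ K := by
  obtain ⟨s, rfl⟩ := (isNoetherianRing_iff_ideal_fg R).1 ‹_› I
  suffices H : ∀ t : Finset R, t ⊆ s → ∃ v ∉ Q, ∀ x ∈ t, v * x ∈ K by
    obtain ⟨v, hv, hvs⟩ := H s subset_rfl
    refine ⟨v, hv, fun x hx => ?_⟩
    have : Ideal.span (s : Set R) ≤ Submodule.comap (LinearMap.mulLeft R v) K :=
      Ideal.span_le.2 fun y hy => by simpa using hvs y hy
    simpa using this hx
  intro t
  induction t using Finset.cons_induction with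
  | empty => exact fun _ => ⟨1, hQ.one_notMem, by simp⟩
  | cons a t hat ih =>
    intro hts
    obtain ⟨v, hv, hvt⟩ := ih fun x hx => hts (by simp [hx])
    obtain ⟨w, hw, hwa⟩ := h a (Ideal.subset_span (hts (by simp)))
    refine ⟨v * w, fun hvw => (hQ.mem_or_mem hvw).elim hv hw, fun x hx => ?_⟩
    rcases Finset.mem_cons.1 hx with rfl | hx
    · rw [mul_assoc]; exact K.mul_mem_left _ hwa
    · rw [mul_comm v w, mul_assoc]; exact K.mul_mem_left _ (hvt x hx)

lemma IsAssocTo.of_colon {K I P : Ideal R} (h : IsAssocTo (Submodule.colon K (I : Set R)) P) :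
    ∃ x, ∃ b ∈ I, ∀ r, r ∈ P ↔ r * (x * b) ∈ K := by
  obtain ⟨hP, x, hx⟩ := h
  by_contra! hcon
  have key : ∀ b ∈ I, ∃ v ∉ P, v * (x * b) ∈ K := by
    intro b hb
    obtain ⟨r, hr⟩ := hcon x b hb
    rcases hr with ⟨hr, hr'⟩ | ⟨hr, hr'⟩
    · refine absurd ?_ hr'
      have := Submodule.mem_colon.1 ((hx r).1 hr) b hb
      simpa [mul_assoc] using this
    · exact ⟨r, hr, hr'⟩
  obtain ⟨v, hv, hvI⟩ := exists_uniform (I := I * Ideal.span {x}) (K := K) hP (by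
    intro y hy
    obtain ⟨b, hb, rfl⟩ := Ideal.mem_mul_span_singleton.1 hy
    simpa [mul_comm] using key b hb)
  refine hv ((hx v).2 (Submodule.mem_colon.2 fun b hb => ?_))
  have := hvI (b * x) (Ideal.mem_mul_span_singleton.2 ⟨b, hb, rfl⟩)
  simpa [mul_assoc, mul_comm, mul_left_comm] using this

lemma IsAssocTo.colon {K I P : Ideal R} (h : IsAssocTo (Submodule.colon K (I : Set R)) P) :
    IsAssocTo K P := by
  obtain ⟨x, b, _, hb⟩ := h.of_colon
  exact ⟨h.1, _, hb⟩

omit [IsNoetherianRing R] in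
lemma mem_colon_ideal {K I : Ideal R} {x : R} :
    x ∈ Submodule.colon K (I : Set R) ↔ ∀ b ∈ I, x * b ∈ K := by
  simp [Submodule.mem_colon]

omit [IsNoetherianRing R] in
/-- A form of Nakayama's lemma at a prime, for modules. -/
lemma exists_smul_eq_zero_of_smul_mem {M : Type*} [AddCommGroup M] [Module R M] [Module.Finite R M]
    {Q : Ideal R} (hQ : Q.IsPrime) {v : R} (hv : v ∉ Q)
    (h : ∀ x : M, v • x ∈ (Q • ⊤ : Submodule R M)) : ∃ w ∉ Q, ∀ x : M, w • x = 0 := by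
  obtain ⟨p, hp, -, hcoeff, hpf⟩ :=
    LinearMap.exists_monic_and_natDegree_eq_and_coeff_mem_pow_and_aeval_eq_zero
      R (LinearMap.lsmul R M v) Q (by rintro _ ⟨x, rfl⟩; exact h x)
  refine ⟨p.eval v, fun hmem => ?_, fun x => ?_⟩
  · rw [Polynomial.eval_eq_sum_range, Finset.sum_range_succ, hp.coeff_natDegree, one_mul] at hmem
    have h1 : ∑ i ∈ Finset.range p.natDegree, p.coeff i * v ^ i ∈ Q :=
      Ideal.sum_mem _ fun i hi => Q.mul_mem_right _ (by
        refine Ideal.pow_le_self ?_ (hcoeff i)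
        have := Finset.mem_range.1 hi
        omega)
    exact hv (hQ.mem_of_pow_mem _ ((Q.add_mem_iff_right h1).1 hmem))
  · have h2 : Polynomial.aeval (LinearMap.lsmul R M v) p =
        algebraMap R (Module.End R M) (p.eval v) := by
      have : LinearMap.lsmul R M v = algebraMap R (Module.End R M) v := rfl
      rw [this, Polynomial.aeval_algebraMap_apply, Polynomial.coe_aeval_eq_eval]
    rw [hpf] at h2
    simpa using (LinearMap.congr_fun h2 x).symm

/-- Nakayama's lemma at a prime, for ideals. -/
lemma exists_mul_mem_of_mul_mem_sup {Q I K : Ideal R} (hQ : Q.IsPrime)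
    (h : ∃ v ∉ Q, ∀ x ∈ I, v * x ∈ K ⊔ Q * I) : ∃ v ∉ Q, ∀ x ∈ I, v * x ∈ K := by
  obtain ⟨v, hv, h⟩ := h
  have key : ∀ y ∈ Submodule.map K.mkQ I, v • y ∈ Q • Submodule.map K.mkQ I := by
    rintro _ ⟨x, hx, rfl⟩
    obtain ⟨c, hc, d, hd, hcd⟩ := Submodule.mem_sup.1 (h x hx)
    have h1 : v • K.mkQ x = K.mkQ d := by
      rw [← map_smul, ← sub_eq_zero, ← map_sub, Submodule.mkQ_apply, Submodule.Quotient.mk_eq_zero,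
        smul_eq_mul, ← hcd]
      simpa using hc
    rw [h1, ← Submodule.map_smul'']
    exact Submodule.mem_map_of_mem hd
  obtain ⟨w, hw, hwI⟩ := exists_smul_eq_zero_of_smul_mem
    (M := Submodule.map K.mkQ I) hQ hv (fun y => by
      rw [Submodule.mem_smul_top_iff]; exact key y y.2)
  refine ⟨w, hw, fun x hx => ?_⟩
  have h2 := congrArg Subtype.val (hwI ⟨_, Submodule.mem_map_of_mem hx⟩)
  rw [Submodule.coe_smul, Submodule.coe_zero, ← map_smul, Submodule.mkQ_apply,
    Submodule.Quotient.mk_eq_zero] at h2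
  exact h2

/-- A prime associated to `K + (y)` above a prime associated to `K`. -/
lemma exists_isAssocTo_sup_span {K P Q : Ideal R} (hP : IsAssocTo K P) (hQ : Q.IsPrime)
    (hPQ : P ≤ Q) {y : R} (hyQ : y ∈ Q) (hy : ∀ x, y * x ∈ K → x ∈ K) :
    ∃ P', IsAssocTo (K ⊔ Ideal.span {y}) P' ∧ P < P' ∧ P' ≤ Q := by
  have hyP := hP.notMem_of_regular hy
  let N : Ideal R := Submodule.colon K (P : Set R)
  by_cases hN : ∀ x ∈ N, ∃ v ∉ Q, v * x ∈ K ⊔ Ideal.span {y}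
  · exfalso
    obtain ⟨v, hv, hvN⟩ := exists_uniform hQ hN
    obtain ⟨w, hw, hwN⟩ := exists_mul_mem_of_mul_mem_sup (K := K) (I := N) hQ ⟨v, hv, by
      intro x hx
      obtain ⟨k, hk, z, hz, hkz⟩ := Submodule.mem_sup.1 (hvN x hx)
      obtain ⟨z, rfl⟩ := Ideal.mem_span_singleton'.1 hz
      have hzN : z ∈ N := mem_colon_ideal.2 fun b hb => by
        refine hy _ ?_
        have h1 : y * (z * b) = v * (x * b) - k * b := by
          rw [← mul_assoc v x b, ← hkz]; ring
        rw [h1]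
        exact K.sub_mem (K.mul_mem_left _ (mem_colon_ideal.1 hx b hb)) (K.mul_mem_right _ hk)
      rw [← hkz, mul_comm z y]
      exact Submodule.add_mem_sup hk (Ideal.mul_mem_mul hyQ hzN)⟩
    obtain ⟨hPp, x, hx⟩ := hP
    exact hw (hPQ ((hx w).2 (hwN x (mem_colon_ideal.2 fun b hb => by
      rw [mul_comm]; exact (hx b).1 hb))))
  · push Not at hN
    obtain ⟨x, hxN, hx⟩ := hN
    obtain ⟨P', hP', hle, hP'Q⟩ := exists_isAssocTo_le (K := K ⊔ Ideal.span {y}) hQ (x := x)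
      fun r hr => by_contra fun h => hx r h hr
    have hyP' : y ∈ P' := hP'.le (Ideal.mem_sup_right (Ideal.mem_span_singleton_self y))
    refine ⟨P', hP', lt_of_le_of_ne (fun r hr => hle r ?_) ?_, hP'Q⟩
    · rw [mul_comm]
      exact Ideal.mem_sup_left (mem_colon_ideal.1 hxN r hr)
    · rintro rfl; exact hyP hyP'

end Elementwise

/-! ### General elements -/

section General

variable {R : Type*} [CommRing R] [IsLocalRing R] [Infinite (ResidueField R)]

lemma exists_mem_forall_notMem {J : Ideal R} {S : Set (Ideal R)} (hS : S.Finite)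
    (h : ∀ e ∈ S, ¬ J ≤ e) : ∃ a ∈ J, ∀ e ∈ S, a ∉ e := by
  induction S, hS using Set.Finite.induction_on with
  | empty => exact ⟨0, J.zero_mem, by simp⟩
  | @insert e S _ hS ih =>
    obtain ⟨a, haJ, ha⟩ := ih fun e he => h e (Set.mem_insert_of_mem _ he)
    by_cases hae : a ∈ e
    swap
    · exact ⟨a, haJ, by rintro f (rfl | hf); exacts [hae, ha f hf]⟩
    obtain ⟨b, hbJ, hbe⟩ := SetLike.not_le_iff_exists.1 (h e (Set.mem_insert _ _))
    obtain ⟨t, ht⟩ := (residue_surjective (R := R)).hasRightInverse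
    have hunit {x y : ResidueField R} (hxy : x ≠ y) : IsUnit (t x - t y) := by
      rw [← residue_ne_zero_iff_isUnit, map_sub, ht, ht]
      exact sub_ne_zero.2 hxy
    have hbad : (⋃ f ∈ S, {x : ResidueField R | a + (t x - t 0) * b ∈ f}).Finite := by
      refine hS.biUnion fun f hf => Set.Subsingleton.finite fun x hx y hy => ?_
      by_contra hne
      have h1 : (t x - t y) * b ∈ f := by
        have := f.sub_mem hx hy
        convert this using 1; ring
      have h2 : b ∈ f := (f.unit_mul_mem_iff_mem (hunit hne)).1 h1
      have h3 := f.sub_mem hx (f.mul_mem_left (t x - t 0) h2)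
      exact ha f hf (by simpa using h3)
    obtain ⟨x, hx⟩ := (hbad.union (Set.finite_singleton (0 : ResidueField R))).exists_notMem
    simp only [Set.mem_union, Set.mem_iUnion, Set.mem_ofPred_eq, Set.mem_singleton_iff, not_or,
      not_exists] at hx
    refine ⟨a + (t x - t 0) * b, J.add_mem haJ (J.mul_mem_left _ hbJ), ?_⟩
    rintro f (rfl | hf)
    · intro hmem
      exact hbe ((f.unit_mul_mem_iff_mem (hunit hx.2)).1 ((f.add_mem_iff_right hae).1 hmem))
    · exact hx.1 f hf

end General

/-- The ideal generated by the first `i` terms of a sequence. -/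
def spanLT {R : Type*} [CommRing R] (a : ℕ → R) (i : ℕ) : Ideal R := Ideal.span (a '' Set.Iio i)

section spanLT

variable {R : Type*} [CommRing R] (a : ℕ → R)

@[simp] lemma spanLT_zero : spanLT a 0 = ⊥ := by simp [spanLT]

lemma spanLT_succ (i : ℕ) : spanLT a (i + 1) = spanLT a i ⊔ Ideal.span {a i} := by
  rw [spanLT, spanLT, ← Ideal.span_union]
  congr 1
  ext x
  simp only [Set.mem_image, Set.mem_Iio, Set.mem_union, Set.mem_singleton_iff,
    Nat.lt_succ_iff_lt_or_eq]
  constructor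
  · rintro ⟨j, hj | rfl, rfl⟩
    exacts [Or.inl ⟨j, hj, rfl⟩, Or.inr rfl]
  · rintro (⟨j, hj, rfl⟩ | rfl)
    exacts [⟨j, Or.inl hj, rfl⟩, ⟨i, Or.inr rfl, rfl⟩]

lemma spanLT_mono {i j : ℕ} (h : i ≤ j) : spanLT a i ≤ spanLT a j :=
  Ideal.span_mono (Set.image_mono (Set.Iio_subset_Iio h))

lemma mem_spanLT {i j : ℕ} (h : j < i) : a j ∈ spanLT a i :=
  Ideal.subset_span ⟨j, h, rfl⟩

variable {a} in
lemma spanLT_le {J : Ideal R} (h : ∀ i, a i ∈ J) (i : ℕ) : spanLT a i ≤ J :=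
  Ideal.span_le.2 (by rintro _ ⟨j, _, rfl⟩; exact h j)

variable {a} in
lemma spanLT_le_of_lt {J : Ideal R} {i : ℕ} (h : ∀ j < i, a j ∈ J) : spanLT a i ≤ J :=
  Ideal.span_le.2 (by rintro _ ⟨j, hj, rfl⟩; exact h j hj)

lemma mem_sup_span_singleton {K : Ideal R} {b x : R} :
    x ∈ K ⊔ Ideal.span {b} ↔ ∃ k ∈ K, ∃ r, x = k + b * r := by
  rw [Submodule.mem_sup]
  constructor
  · rintro ⟨k, hk, z, hz, rfl⟩
    obtain ⟨r, rfl⟩ := Ideal.mem_span_singleton.1 hz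
    exact ⟨k, hk, r, rfl⟩
  · rintro ⟨k, hk, r, rfl⟩
    exact ⟨k, hk, b * r, Ideal.mem_span_singleton.2 ⟨r, rfl⟩, rfl⟩

lemma exists_general_sequence {R : Type*} [CommRing R] [IsLocalRing R] [Infinite (ResidueField R)]
    (J : Ideal R) (E : Ideal R → Set (Ideal R)) (hE : ∀ K, (E K).Finite) :
    ∃ a : ℕ → R, ∀ i, a i ∈ J ∧ ∀ e ∈ E (spanLT a i), ¬ J ≤ e → a i ∉ e := by
  have key (K : Ideal R) : ∃ x ∈ J, ∀ e ∈ E K, ¬ J ≤ e → x ∉ e := by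
    obtain ⟨x, hx, h⟩ := exists_mem_forall_notMem (J := J) (S := {e | e ∈ E K ∧ ¬ J ≤ e})
      ((hE K).subset fun e he => he.1) fun e he => he.2
    exact ⟨x, hx, fun e he hJ => h e ⟨he, hJ⟩⟩
  choose f hfJ hf using key
  let S : ℕ → Ideal R := fun i => Nat.rec ⊥ (fun _ K => K ⊔ Ideal.span {f K}) i
  have hS : ∀ i, spanLT (fun i => f (S i)) i = S i := by
    intro i
    induction i with
    | zero => simp [S]
    | succ i ih => rw [spanLT_succ, ih]
  refine ⟨fun i => f (S i), fun i => ⟨hfJ _, ?_⟩⟩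
  rw [hS]
  exact hf _

end spanLT

/-! ### `Ext` of modules, elementwise -/

section ExtElementwise

variable (R : Type u) [CommRing R]

/-- `Ext` of two modules in the universe of the ring. -/
abbrev ExtMod (M N : Type u) [AddCommGroup M] [Module R M] [AddCommGroup N] [Module R N] (k : ℕ) :
    Type u :=
  Abelian.Ext.{u} (ModuleCat.of R M) (ModuleCat.of R N) k

variable {R}
variable {A B C N M : Type u} [AddCommGroup A] [Module R A] [AddCommGroup B] [Module R B]
  [AddCommGroup C] [Module R C] [AddCommGroup N] [Module R N] [AddCommGroup M] [Module R M]

namespace ExtMod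

/-- Contravariant functoriality of `Ext`. -/
def pull (f : A →ₗ[R] B) {k : ℕ} (e : ExtMod R B N k) : ExtMod R A N k :=
  (Abelian.Ext.mk₀ (ModuleCat.ofHom f)).comp e (zero_add k)

/-- Covariant functoriality of `Ext`. -/
def push (f : A →ₗ[R] B) {k : ℕ} (e : ExtMod R M A k) : ExtMod R M B k :=
  e.comp (Abelian.Ext.mk₀ (ModuleCat.ofHom f)) (add_zero k)

variable {k : ℕ}

lemma pull_smul (f : A →ₗ[R] B) (r : R) (e : ExtMod R B N k) : pull f (r • e) = r • pull f e := by
  simp [pull]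

lemma pull_sub (f : A →ₗ[R] B) (e e' : ExtMod R B N k) :
    pull f (e - e') = pull f e - pull f e' :=
  map_sub ((Abelian.Ext.mk₀ (ModuleCat.ofHom f)).precomp (ModuleCat.of R N) (zero_add k)) e e'

lemma push_smul (f : A →ₗ[R] B) (r : R) (e : ExtMod R M A k) : push f (r • e) = r • push f e := by
  simp [push]

lemma pull_pull (f : A →ₗ[R] B) (g : B →ₗ[R] C) (e : ExtMod R C N k) :
    pull f (pull g e) = pull (g ∘ₗ f) e := by
  simp [pull]

lemma pull_smul_id (r : R) (e : ExtMod R A N k) : pull (r • LinearMap.id) e = r • e := by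
  have : ModuleCat.ofHom (r • LinearMap.id : A →ₗ[R] A) = r • 𝟙 (ModuleCat.of R A) := rfl
  rw [pull, this, Abelian.Ext.mk₀_smul]
  simp

lemma push_smul_id (r : R) (e : ExtMod R M A k) : push (r • LinearMap.id) e = r • e := by
  have : ModuleCat.ofHom (r • LinearMap.id : A →ₗ[R] A) = r • 𝟙 (ModuleCat.of R A) := rfl
  rw [push, this, Abelian.Ext.mk₀_smul]
  simp

lemma pull_id (e : ExtMod R A N k) : pull (LinearMap.id) e = e := by
  simpa using pull_smul_id (1 : R) e

lemma smul_eq_zero_of_smul_eq_zero {r : R} (h : ∀ x : A, r • x = 0) (e : ExtMod R A N k) :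
    r • e = 0 := by
  have : (r • LinearMap.id : A →ₗ[R] A) = 0 := by ext x; simp [h]
  rw [← pull_smul_id, this]
  have : ModuleCat.ofHom (0 : A →ₗ[R] A) = 0 := rfl
  simp [pull, this]

variable {f : A →ₗ[R] B} {g : B →ₗ[R] C}

/-- The short complex of an exact sequence of linear maps. -/
abbrev shortComplex (hex : Function.Exact f g) : ShortComplex (ModuleCat.{u} R) :=
  ShortComplex.mk (ModuleCat.ofHom f) (ModuleCat.ofHom g) (by
    ext x; exact hex.apply_apply_eq_zero x)

lemma shortExact (hf : Function.Injective f) (hex : Function.Exact f g)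
    (hg : Function.Surjective g) : (shortComplex hex).ShortExact where
  exact := by
    rw [ShortComplex.moduleCat_exact_iff_range_eq_ker]; exact (LinearMap.exact_iff.1 hex).symm
  mono_f := (ModuleCat.mono_iff_injective _).2 hf
  epi_g := (ModuleCat.epi_iff_surjective _).2 hg

lemma exists_pull_eq (hf : Function.Injective f) (hex : Function.Exact f g)
    (hg : Function.Surjective g) (e : ExtMod R B N k) (h : pull f e = 0) :
    ∃ e' : ExtMod R C N k, pull g e' = e :=
  Abelian.Ext.contravariant_sequence_exact₂ (shortExact hf hex hg) _ e h

lemma exists_pull_connecting (hf : Function.Injective f) (hex : Function.Exact f g)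
    (hg : Function.Surjective g) (N : Type u) [AddCommGroup N] [Module R N] (k : ℕ) :
    ∃ δ : ExtMod R A N k → ExtMod R C N (k + 1),
      (∀ (r : R) e, δ (r • e) = r • δ e) ∧
      (∀ e, δ e = 0 → ∃ e' : ExtMod R B N k, pull f e' = e) ∧
      (∀ e : ExtMod R C N (k + 1), pull g e = 0 → ∃ e', δ e' = e) := by
  refine ⟨fun e => (shortExact hf hex hg).extClass.comp e (add_comm 1 k), fun r e => ?_,
    fun e he => ?_, fun e he => ?_⟩
  · simp
  · exact Abelian.Ext.contravariant_sequence_exact₁ (shortExact hf hex hg) _ e (add_comm 1 k) he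
  · exact Abelian.Ext.contravariant_sequence_exact₃ (shortExact hf hex hg) _ e he (add_comm 1 k)

lemma exists_push_connecting (hf : Function.Injective f) (hex : Function.Exact f g)
    (hg : Function.Surjective g) (M : Type u) [AddCommGroup M] [Module R M] (k : ℕ) :
    ∃ δ : ExtMod R M C k → ExtMod R M A (k + 1),
      (∀ (r : R) e, δ (r • e) = r • δ e) ∧
      (∀ e, δ e = 0 → ∃ e' : ExtMod R M B k, push g e' = e) ∧
      (∀ e : ExtMod R M A (k + 1), push f e = 0 → ∃ e', δ e' = e) := by
  refine ⟨fun e => e.comp (shortExact hf hex hg).extClass rfl, fun r e => ?_,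
    fun e he => ?_, fun e he => ?_⟩
  · simp
  · exact Abelian.Ext.covariant_sequence_exact₃ _ (shortExact hf hex hg) e rfl he
  · exact Abelian.Ext.covariant_sequence_exact₁ _ (shortExact hf hex hg) e he rfl

/-- The class in degree zero of a linear map. -/
def ofLinearMap (φ : M →ₗ[R] N) : ExtMod R M N 0 := Abelian.Ext.mk₀ (ModuleCat.ofHom φ)

lemma exists_ofLinearMap (e : ExtMod R M N 0) : ∃ φ : M →ₗ[R] N, ofLinearMap φ = e := by
  obtain ⟨φ, rfl⟩ := (Abelian.Ext.mk₀_bijective _ _).2 e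
  exact ⟨φ.hom, rfl⟩

lemma smul_ofLinearMap (r : R) (φ : M →ₗ[R] N) : r • ofLinearMap φ = ofLinearMap (r • φ) := by
  rw [ofLinearMap, ofLinearMap, ← Abelian.Ext.mk₀_smul]
  rfl

lemma ofLinearMap_eq_zero_iff (φ : M →ₗ[R] N) : ofLinearMap φ = 0 ↔ φ = 0 := by
  rw [ofLinearMap, Abelian.Ext.mk₀_eq_zero_iff]
  exact ⟨fun h => congrArg ModuleCat.Hom.hom h, fun h => by rw [h]; rfl⟩

lemma pull_ofLinearMap (f : A →ₗ[R] B) (φ : B →ₗ[R] N) :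
    pull f (ofLinearMap φ) = ofLinearMap (φ ∘ₗ f) := by
  simp [pull, ofLinearMap]

lemma pull_zero_right (f : A →ₗ[R] B) : pull f (0 : ExtMod R B N k) = 0 := by
  simpa using pull_sub f (0 : ExtMod R B N k) 0

lemma eq_zero_of_ring (hk : 0 < k) (e : ExtMod R R N k) : e = 0 := by
  obtain ⟨k, rfl⟩ := Nat.exists_eq_succ_of_ne_zero hk.ne'
  have : Projective (ModuleCat.of R R) := inferInstance
  exact Abelian.Ext.eq_zero_of_projective e

/-- Pulling back along a surjection is injective when the kernel has no `Ext` one degree lower. -/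
lemma eq_zero_of_pull_eq_zero (hf : Function.Injective f) (hex : Function.Exact f g)
    (hg : Function.Surjective g) (hA : ∀ j, j + 1 = k → ∀ e : ExtMod R A N j, e = 0)
    (e : ExtMod R C N k) (he : pull g e = 0) : e = 0 := by
  obtain _ | k := k
  · obtain ⟨φ, rfl⟩ := exists_ofLinearMap e
    rw [pull_ofLinearMap, ofLinearMap_eq_zero_iff] at he
    rw [ofLinearMap_eq_zero_iff]
    ext x
    obtain ⟨y, rfl⟩ := hg x
    exact LinearMap.congr_fun he y
  · obtain ⟨δ, hδ, _, h⟩ := exists_pull_connecting hf hex hg N k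
    obtain ⟨e', rfl⟩ := h e he
    rw [hA k rfl e']
    simpa using hδ 0 0

end ExtMod

lemma exists_extMod_smul_eq_zero (p : Ideal R) (hp : p.IsPrime) (n : ℕ)
    (h : ExtVanishesAt M N (n + 1) p hp) (e : ExtMod R M N (n + 1)) : ∃ s ∉ p, s • e = 0 := by
  let P := projectiveResolution (ModuleCat.of R M)
  obtain ⟨f, hf, rfl⟩ := P.extMk_surjective e (n + 2) rfl
  let K := P.complex.linearYonedaObj R (ModuleCat.of R N)
  let S := K.sc' n (n + 1) (n + 2)
  let iso : ((Ext R (ModuleCat.{u} R) (n + 1)).obj (Opposite.op (ModuleCat.of R M))).obj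
      (ModuleCat.of R N) ≅ _ :=
    P.isoExt (n + 1) (ModuleCat.of R N) ≪≫ K.homologyIsoSc' n (n + 1) (n + 2) (by simp) (by simp)
      ≪≫ S.moduleCatHomologyIso
  have hfz : ∃ z : LinearMap.ker S.g.hom, z.1 = f := ⟨⟨f, hf⟩, rfl⟩
  obtain ⟨z, hz⟩ := hfz
  obtain ⟨q, hq⟩ : ∃ q : S.moduleCatLeftHomologyData.H, q = Submodule.Quotient.mk z := ⟨_, rfl⟩
  rw [ExtVanishesAt, LocalizedModule.subsingleton_iff] at h
  obtain ⟨s, hs, hs0⟩ := h (iso.toLinearEquiv.symm q)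
  refine ⟨s, hs, ?_⟩
  have hs1 := congrArg iso.toLinearEquiv hs0
  rw [map_smul, LinearEquiv.apply_symm_apply, map_zero, hq] at hs1
  obtain ⟨x, hx⟩ := (Submodule.Quotient.mk_eq_zero _ (x := s • z)).1 hs1
  have hx : P.complex.d (n + 1) n ≫ x = s • f :=
    (congrArg Subtype.val hx).trans (congrArg (s • ·) hz)
  rw [Abelian.Ext.smul_eq_comp_mk₀, ProjectiveResolution.extMk_comp_mk₀,
    ProjectiveResolution.extMk_eq_zero_iff _ _ _ _ _ n rfl]
  exact ⟨x, by simpa using hx⟩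

end ExtElementwise

section ExtVanishing

variable {R : Type u} [CommRing R] {M : Type u} [AddCommGroup M] [Module R M]

namespace ExtMod

/-- Multiplication by `y` on `R ⧸ K`. -/
def quotMul (K : Ideal R) (y : R) : (R ⧸ K) →ₗ[R] (R ⧸ K) := y • LinearMap.id

lemma quotMul_injective {K : Ideal R} {y : R} (hy : ∀ x, y * x ∈ K → x ∈ K) :
    Function.Injective (quotMul K y) := by
  rw [injective_iff_map_eq_zero]
  intro x hx
  obtain ⟨x, rfl⟩ := Ideal.Quotient.mk_surjective x
  rw [Ideal.Quotient.eq_zero_iff_mem]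
  refine hy x ?_
  rw [← Ideal.Quotient.eq_zero_iff_mem, map_mul]
  simpa [quotMul, Algebra.smul_def] using hx

lemma quotMul_exact (K : Ideal R) (y : R) :
    Function.Exact (quotMul K y)
      (Submodule.factor (le_sup_left : K ≤ K ⊔ Ideal.span {y})) := by
  intro x
  obtain ⟨x, rfl⟩ := Submodule.mkQ_surjective _ x
  rw [Submodule.factor_mk, Submodule.mkQ_apply, Submodule.mkQ_apply, Submodule.Quotient.mk_eq_zero,
    mem_sup_span_singleton]
  constructor
  · rintro ⟨k, hk, r, rfl⟩
    refine ⟨Submodule.Quotient.mk r, ?_⟩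
    rw [quotMul, LinearMap.smul_apply, LinearMap.id_apply, ← Submodule.Quotient.mk_smul, 
      Submodule.Quotient.eq]
    simpa using hk
  · rintro ⟨r, hr⟩
    obtain ⟨r, rfl⟩ := Submodule.mkQ_surjective _ r
    rw [quotMul, LinearMap.smul_apply, LinearMap.id_apply, Submodule.mkQ_apply, 
      ← Submodule.Quotient.mk_smul, Submodule.Quotient.eq] at hr
    refine ⟨x - y * r, by simpa using K.neg_mem hr, r, by ring⟩

lemma exists_quot_connecting {K : Ideal R} {y : R} (hy : ∀ x, y * x ∈ K → x ∈ K)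
    (M : Type u) [AddCommGroup M] [Module R M] (k : ℕ) :
    ∃ δ : ExtMod R M (R ⧸ (K ⊔ Ideal.span {y})) k → ExtMod R M (R ⧸ K) (k + 1),
      (∀ (r : R) e, δ (r • e) = r • δ e) ∧
      (∀ e, δ e = 0 → (∀ e' : ExtMod R M (R ⧸ K) k, e' = 0) → e = 0) ∧
      (∀ e : ExtMod R M (R ⧸ K) (k + 1), y • e = 0 → ∃ e', δ e' = e) := by
  obtain ⟨δ, h1, h2, h3⟩ := exists_push_connecting (quotMul_injective hy) (quotMul_exact K y)
    (Submodule.factor_surjective _) M k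
  refine ⟨δ, h1, fun e he h => ?_, fun e he => h3 e ?_⟩
  · obtain ⟨e', rfl⟩ := h2 e he
    rw [h e']
    simp [push]
  · rw [quotMul, push_smul_id, he]

lemma eq_zero_of_pow_smul_eq_zero {N : Type*} [AddCommGroup N] [Module R N] {y : R}
    (H : ∀ e : N, y • e = 0 → e = 0) {n : ℕ} {e : N} (h : y ^ n • e = 0) : e = 0 := by
  induction n with
  | zero => simpa using h
  | succ n ih => exact ih (H _ (by rwa [smul_smul, ← pow_succ']))

/-- Vanishing of `Ext` from modules killed by powers of a regular sequence. -/
lemma eq_zero_of_regular {y : ℕ → R} {s : ℕ}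
    (hy : ∀ i < s, ∀ x, y i * x ∈ spanLT y i → x ∈ spanLT y i)
    (hM : ∀ i < s, ∃ n : ℕ, ∀ x : M, y i ^ n • x = 0) {j i : ℕ} (hij : j + i < s)
    (e : ExtMod R M (R ⧸ spanLT y i) j) : e = 0 := by
  obtain ⟨n, hn⟩ := hM i (by omega)
  induction j generalizing i n with
  | zero =>
    refine eq_zero_of_pow_smul_eq_zero (fun e he => ?_) (smul_eq_zero_of_smul_eq_zero hn e)
    obtain ⟨φ, rfl⟩ := exists_ofLinearMap e
    rw [smul_ofLinearMap, ofLinearMap_eq_zero_iff] at he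
    rw [ofLinearMap_eq_zero_iff]
    ext x
    refine quotMul_injective (hy i (by omega)) ?_
    simpa [quotMul] using LinearMap.congr_fun he x
  | succ j ih =>
    refine eq_zero_of_pow_smul_eq_zero (fun e he => ?_) (smul_eq_zero_of_smul_eq_zero hn e)
    obtain ⟨δ, h1, -, h3⟩ := exists_quot_connecting (hy i (by omega)) M j
    obtain ⟨e', rfl⟩ := h3 e he
    have hi := fun n hn => ih (i := i + 1) (by omega) (n := n) (hn := hn)
    rw [spanLT_succ] at hi
    obtain ⟨m, hm⟩ := hM (i + 1) (by omega)
    rw [hi m hm e']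
    simpa using h1 0 0

end ExtMod
end ExtVanishing

section ExtLocalized

variable {R : Type u} [CommRing R]
variable {A B C N M : Type u} [AddCommGroup A] [Module R A] [AddCommGroup B] [Module R B]
  [AddCommGroup C] [Module R C] [AddCommGroup N] [Module R N] [AddCommGroup M] [Module R M]

namespace ExtMod

variable {k : ℕ}

lemma push_push (f : A →ₗ[R] B) (g : B →ₗ[R] C) (e : ExtMod R M A k) :
    push g (push f e) = push (g ∘ₗ f) e := by
  simp [push]

lemma push_id (e : ExtMod R M A k) : push LinearMap.id e = e := by
  simpa using push_smul_id (1 : R) e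

lemma push_zero_right (f : A →ₗ[R] B) : push f (0 : ExtMod R M A k) = 0 := by
  simpa using push_smul f (0 : R) (0 : ExtMod R M A k)

lemma eq_zero_of_push_equiv (φ : A ≃ₗ[R] B) {e : ExtMod R M A k}
    (h : push φ.toLinearMap e = 0) : e = 0 := by
  have := push_push φ.toLinearMap φ.symm.toLinearMap e
  rw [h, push_zero_right] at this
  simpa [push_id] using this.symm

/-- The quotient by the ideal generated by an empty sequence. -/
def quotSpanLTZero (y : ℕ → R) : R ≃ₗ[R] (R ⧸ spanLT y 0) :=
  (Submodule.quotEquivOfEqBot _ (spanLT_zero y)).symm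

/-- Vanishing of `Ext` into the ring from modules killed by powers of a regular sequence. -/
lemma eq_zero_of_regular' {y : ℕ → R} {s : ℕ}
    (hy : ∀ i < s, ∀ x, y i * x ∈ spanLT y i → x ∈ spanLT y i)
    (hM : ∀ i < s, ∃ n : ℕ, ∀ x : M, y i ^ n • x = 0) {j : ℕ} (hj : j < s)
    (e : ExtMod R M R j) : e = 0 :=
  eq_zero_of_push_equiv (quotSpanLTZero y) (eq_zero_of_regular hy hM (by omega) _)

lemma exists_smul_linearMap_eq_zero {y : ℕ → R} {s : ℕ}
    (hy : ∀ i < s, ∀ x, y i * x ∈ spanLT y i → x ∈ spanLT y i)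
    (hM : ∀ i < s, ∀ x : M, y i • x = 0) {p : Ideal R} {z : R}
    (h : ∀ e : ExtMod R M R s, ∃ t ∉ p, (t * z) • e = 0) (φ : M →ₗ[R] (R ⧸ spanLT y s)) :
    ∃ t ∉ p, (t * z) • φ = 0 := by
  have key : ∀ i ≤ s, ∀ e : ExtMod R M (R ⧸ spanLT y i) (s - i), ∃ t ∉ p, (t * z) • e = 0 := by
    intro i
    induction i with
    | zero =>
      intro _ e
      obtain ⟨t, ht, h0⟩ := h (push (quotSpanLTZero y).symm.toLinearMap e)
      rw [← push_smul] at h0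
      exact ⟨t, ht, eq_zero_of_push_equiv _ h0⟩
    | succ i ih =>
      intro hi
      obtain ⟨m, hm⟩ : ∃ m, s - i = m + 1 := ⟨s - i - 1, by omega⟩
      have hm' : s - (i + 1) = m := by omega
      have ih := ih (by omega)
      rw [hm] at ih
      rw [hm']
      have hz := fun e => eq_zero_of_regular (M := M) hy
        (fun i hi => ⟨1, by simpa using hM i hi⟩) (j := m) (i := i) (by omega) e
      obtain ⟨δ, h1, h2, -⟩ := exists_quot_connecting (hy i (by omega)) M m
      rw [spanLT_succ]
      intro e
      obtain ⟨t, ht, h0⟩ := ih (δ e)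
      exact ⟨t, ht, h2 _ (by rw [h1, h0]) hz⟩
  have := key s le_rfl
  rw [Nat.sub_self] at this
  obtain ⟨t, ht, h0⟩ := this (ofLinearMap φ)
  rw [smul_ofLinearMap, ofLinearMap_eq_zero_iff] at h0
  exact ⟨t, ht, h0⟩

end ExtMod

/-- The localization of `Ext^k(M, N)` at `p` vanishes, elementwise. -/
def ExtLocZero (p : Ideal R) (N : Type u) [AddCommGroup N] [Module R N]
    (M : Type u) [AddCommGroup M] [Module R M] (k : ℕ) : Prop :=
  ∀ e : ExtMod R M N k, ∃ s ∉ p, s • e = 0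

/-- The localization of `Ext^k(M, N)` at `p` is cyclic, elementwise. -/
def ExtLocCyclic (p : Ideal R) (N : Type u) [AddCommGroup N] [Module R N]
    (M : Type u) [AddCommGroup M] [Module R M] (k : ℕ) : Prop :=
  ∃ e₀ : ExtMod R M N k, ∀ e : ExtMod R M N k, ∃ s ∉ p, ∃ r : R, s • e = r • e₀

variable {p : Ideal R} {f : A →ₗ[R] B} {g : B →ₗ[R] C} {k : ℕ}

open ExtMod

lemma ExtLocZero.left [hp : p.IsPrime] (hf : Function.Injective f) (hex : Function.Exact f g)
    (hg : Function.Surjective g) (hB : ExtLocZero p N B k) (hC : ExtLocZero p N C (k + 1)) :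
    ExtLocZero p N A k := by
  intro e
  obtain ⟨δ, h1, h2, -⟩ := exists_pull_connecting hf hex hg N k
  obtain ⟨s, hs, h⟩ := hC (δ e)
  obtain ⟨e', he'⟩ := h2 (s • e) (by rw [h1, h])
  obtain ⟨t, ht, h'⟩ := hB e'
  exact ⟨t * s, hp.mul_notMem ht hs, by rw [mul_smul, ← he', ← pull_smul, h', pull_zero_right]⟩

lemma ExtLocCyclic.left [hp : p.IsPrime] (hf : Function.Injective f) (hex : Function.Exact f g)
    (hg : Function.Surjective g) (hB : ExtLocCyclic p N B k) (hC : ExtLocZero p N C (k + 1)) :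
    ExtLocCyclic p N A k := by
  obtain ⟨e₀, h₀⟩ := hB
  refine ⟨pull f e₀, fun e => ?_⟩
  obtain ⟨δ, h1, h2, -⟩ := exists_pull_connecting hf hex hg N k
  obtain ⟨s, hs, h⟩ := hC (δ e)
  obtain ⟨e', he'⟩ := h2 (s • e) (by rw [h1, h])
  obtain ⟨t, ht, r, h'⟩ := h₀ e'
  exact ⟨t * s, hp.mul_notMem ht hs, r, by rw [mul_smul, ← he', ← pull_smul, h', pull_smul]⟩

lemma ExtLocZero.right [hp : p.IsPrime] (hf : Function.Injective f) (hex : Function.Exact f g)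
    (hg : Function.Surjective g) (hA : ExtLocZero p N A k) (hB : ExtLocZero p N B (k + 1)) :
    ExtLocZero p N C (k + 1) := by
  intro e
  obtain ⟨δ, h1, -, h3⟩ := exists_pull_connecting hf hex hg N k
  obtain ⟨s, hs, h⟩ := hB (pull g e)
  obtain ⟨e', he'⟩ := h3 (s • e) (by rw [pull_smul, h])
  obtain ⟨t, ht, h'⟩ := hA e'
  exact ⟨t * s, hp.mul_notMem ht hs, by
    rw [mul_smul, ← he', ← h1, h']; simpa using h1 0 0⟩

lemma ExtLocCyclic.right [hp : p.IsPrime] (hf : Function.Injective f) (hex : Function.Exact f g)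
    (hg : Function.Surjective g) (hA : ExtLocCyclic p N A k) (hB : ExtLocZero p N B (k + 1)) :
    ExtLocCyclic p N C (k + 1) := by
  obtain ⟨e₀, h₀⟩ := hA
  obtain ⟨δ, h1, -, h3⟩ := exists_pull_connecting hf hex hg N k
  refine ⟨δ e₀, fun e => ?_⟩
  obtain ⟨s, hs, h⟩ := hB (pull g e)
  obtain ⟨e', he'⟩ := h3 (s • e) (by rw [pull_smul, h])
  obtain ⟨t, ht, r, h'⟩ := h₀ e'
  exact ⟨t * s, hp.mul_notMem ht hs, r, by rw [mul_smul, ← he', ← h1, h', h1]⟩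

lemma ExtLocZero.of_surjective (hg : Function.Surjective g)
    (hK : ∀ j ≤ k, ∀ e : ExtMod R (LinearMap.ker g) N j, e = 0) (hB : ExtLocZero p N B k) :
    ExtLocZero p N C k := by
  intro e
  obtain ⟨s, hs, h⟩ := hB (pull g e)
  exact ⟨s, hs, eq_zero_of_pull_eq_zero (Submodule.subtype_injective _)
    (LinearMap.exact_subtype_ker_map g) hg (fun j hj => hK j (by omega)) _ (by rw [pull_smul, h])⟩

lemma ExtLocCyclic.of_surjective (hg : Function.Surjective g)
    (hK : ∀ j ≤ k, ∀ e : ExtMod R (LinearMap.ker g) N j, e = 0) (hB : ExtLocCyclic p N B k) :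
    ExtLocCyclic p N C k := by
  obtain ⟨e₀, h₀⟩ := hB
  have hinj := Submodule.subtype_injective (LinearMap.ker g)
  obtain ⟨c₀, rfl⟩ := exists_pull_eq hinj (LinearMap.exact_subtype_ker_map g) hg e₀
    (hK k le_rfl _)
  refine ⟨c₀, fun e => ?_⟩
  obtain ⟨s, hs, r, h⟩ := h₀ (pull g e)
  refine ⟨s, hs, r, sub_eq_zero.1 (eq_zero_of_pull_eq_zero hinj
    (LinearMap.exact_subtype_ker_map g) hg (fun j hj => hK j (by omega)) _ ?_)⟩
  rw [pull_sub, pull_smul, pull_smul, h, sub_self]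

lemma ker_rangeRestrict_ext (f : A →ₗ[R] B)
    (hK : ∀ j ≤ k, ∀ e : ExtMod R (LinearMap.ker f) N j, e = 0) :
    ∀ j ≤ k, ∀ e : ExtMod R (LinearMap.ker f.rangeRestrict) N j, e = 0 := by
  rwa [LinearMap.ker_rangeRestrict]

lemma exact_subtype_range (hex : Function.Exact f g) :
    Function.Exact (LinearMap.range f).subtype g := by
  rw [LinearMap.exact_iff] at hex ⊢
  rw [hex, Submodule.range_subtype]

lemma ExtLocZero.fourTerm [p.IsPrime] (hex : Function.Exact f g) (hg : Function.Surjective g)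
    (hK : ∀ j ≤ k, ∀ e : ExtMod R (LinearMap.ker f) N j, e = 0)
    (hA : ExtLocZero p N A k) (hB : ExtLocZero p N B (k + 1)) : ExtLocZero p N C (k + 1) :=
  ExtLocZero.right (Submodule.subtype_injective _) (exact_subtype_range hex) hg
    (hA.of_surjective f.surjective_rangeRestrict (ker_rangeRestrict_ext f hK)) hB

lemma ExtLocCyclic.fourTerm [p.IsPrime] (hex : Function.Exact f g) (hg : Function.Surjective g)
    (hK : ∀ j ≤ k, ∀ e : ExtMod R (LinearMap.ker f) N j, e = 0)
    (hA : ExtLocCyclic p N A k) (hB : ExtLocZero p N B (k + 1)) : ExtLocCyclic p N C (k + 1) :=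
  ExtLocCyclic.right (Submodule.subtype_injective _) (exact_subtype_range hex) hg
    (hA.of_surjective f.surjective_rangeRestrict (ker_rangeRestrict_ext f hK)) hB

/-- If the localized `Ext` of `M` is cyclic, and multiplication by `x` factors through
multiplication by `a` on `M`, then some `s * x - a * r` kills it. -/
lemma ExtLocCyclic.exists_smul_eq_zero (h : ExtLocCyclic p N M k) {a x : R}
    (φ : M →ₗ[R] M) (hφ : ∀ m, a • φ m = x • m) :
    ∃ s ∉ p, ∃ r : R, ∀ e : ExtMod R M N k, ∃ t ∉ p, (t * (s * x - a * r)) • e = 0 := by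
  obtain ⟨e₀, h₀⟩ := h
  obtain ⟨s, hs, r, h⟩ := h₀ (pull φ e₀)
  have hx : x • e₀ = a • pull φ e₀ := by
    have : (a • LinearMap.id : M →ₗ[R] M) ∘ₗ φ = x • LinearMap.id := by
      ext m; simpa using hφ m
    rw [← pull_smul_id x, ← this, ← pull_pull, pull_smul_id, pull_smul]
  have hy : (s * x - a * r) • e₀ = 0 := by
    rw [sub_smul, mul_smul, hx, smul_comm s a, h, mul_smul, sub_self]
  refine ⟨s, hs, r, fun e => ?_⟩
  obtain ⟨t, ht, r', h'⟩ := h₀ e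
  exact ⟨t, ht, by rw [mul_comm, mul_smul, h', smul_comm, hy, smul_zero]⟩

lemma ExtLocZero.ring (hp : p ≠ ⊤) (hk : 0 < k) : ExtLocZero p N R k := fun e =>
  ⟨1, (Ideal.ne_top_iff_one p).1 hp, by rw [eq_zero_of_ring hk e, smul_zero]⟩

/-- Transport along a linear equivalence. -/
lemma ExtLocZero.of_equiv (φ : A ≃ₗ[R] B) (h : ExtLocZero p N A k) : ExtLocZero p N B k := by
  intro e
  obtain ⟨s, hs, h0⟩ := h (pull φ.toLinearMap e)
  refine ⟨s, hs, ?_⟩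
  rw [← pull_smul] at h0
  have := pull_pull φ.symm.toLinearMap φ.toLinearMap (s • e)
  rw [h0, pull_zero_right] at this
  simpa [pull_id] using this.symm

lemma ExtLocCyclic.of_equiv (φ : A ≃ₗ[R] B) (h : ExtLocCyclic p N A k) :
    ExtLocCyclic p N B k := by
  obtain ⟨e₀, h₀⟩ := h
  refine ⟨pull φ.symm.toLinearMap e₀, fun e => ?_⟩
  obtain ⟨s, hs, r, h0⟩ := h₀ (pull φ.toLinearMap e)
  refine ⟨s, hs, r, ?_⟩
  have := congrArg (pull φ.symm.toLinearMap) h0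
  rw [pull_smul, pull_smul, pull_pull] at this
  simpa [pull_id] using this

/-- Quotients by a regular sequence: `Ext^i(R/(a_0,…,a_{i-1}), R)` is cyclic and the higher ones
vanish. -/
lemma extLoc_quot_spanLT [hp : p.IsPrime] {a : ℕ → R} {s : ℕ}
    (ha : ∀ i < s, ∀ x, a i * x ∈ spanLT a i → x ∈ spanLT a i) {i : ℕ} (hi : i ≤ s) :
    ExtLocCyclic p R (R ⧸ spanLT a i) i ∧ ∀ k, i < k → ExtLocZero p R (R ⧸ spanLT a i) k := by
  induction i with
  | zero =>
    refine ⟨ExtLocCyclic.of_equiv (quotSpanLTZero a) ⟨ofLinearMap LinearMap.id, fun e => ?_⟩,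
      fun k hk => (ExtLocZero.ring hp.ne_top hk).of_equiv (quotSpanLTZero a)⟩
    obtain ⟨φ, rfl⟩ := exists_ofLinearMap e
    refine ⟨1, (Ideal.ne_top_iff_one p).1 hp.ne_top, φ 1, ?_⟩
    rw [one_smul, smul_ofLinearMap]
    congr 1
    ext
    simp
  | succ i ih =>
    obtain ⟨h1, h2⟩ := ih (by omega)
    rw [spanLT_succ]
    have hinj := quotMul_injective (ha i (by omega))
    have hex := quotMul_exact (spanLT a i) (a i)
    refine ⟨h1.right hinj hex (Submodule.factor_surjective _) (h2 _ (by omega)), fun k hk => ?_⟩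
    obtain ⟨k, rfl⟩ : ∃ m, k = m + 1 := ⟨k - 1, by omega⟩
    exact (h2 k (by omega)).right hinj hex (Submodule.factor_surjective _) (h2 _ (by omega))

end ExtLocalized

/-! ### Heights of primes -/

section Height

variable {R : Type u} [CommRing R]

/-- The height of an ideal as a natural number. -/
def natHeight (Q : Ideal R) : ℕ := Q.height.toNat

variable [IsNoetherianRing R]

lemma coe_natHeight {Q : Ideal R} (hQ : Q.IsPrime) : (natHeight Q : ℕ∞) = Q.height :=
  ENat.natCast_toNat Ideal.height_ne_top_of_isPrime

lemma dimAt_eq {Q : Ideal R} (hQ : Q.IsPrime) :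
    dimAt Q hQ = ((natHeight Q : ℕ∞) : WithBot ℕ∞) := by
  rw [coe_natHeight hQ, dimAt, IsLocalization.AtPrime.ringKrullDim_eq_height Q]

lemma natHeight_lt {P Q : Ideal R} (hP : P.IsPrime) (hQ : Q.IsPrime) (h : P < Q) :
    natHeight P < natHeight Q := by
  have := Ideal.height_strict_mono_of_isPrime_of_isPrime h
  rwa [← coe_natHeight hP, ← coe_natHeight hQ, Nat.cast_lt] at this

lemma natHeight_le {P Q : Ideal R} (hP : P.IsPrime) (hQ : Q.IsPrime) (h : P ≤ Q) :
    natHeight P ≤ natHeight Q := by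
  obtain rfl | h := h.eq_or_lt
  · rfl
  · exact (natHeight_lt hP hQ h).le

lemma natCast_le_idealHeight {K : Ideal R} {s : ℕ} :
    (s : WithBot ℕ∞) ≤ idealHeight K ↔ ∀ Q : Ideal R, Q.IsPrime → K ≤ Q → s ≤ natHeight Q := by
  rw [idealHeight, le_sInf_iff]
  constructor
  · intro h Q hQ hK
    have := h _ ⟨Q, hQ, hK, rfl⟩
    rw [dimAt_eq hQ] at this
    exact_mod_cast this
  · rintro h _ ⟨Q, hQ, hK, rfl⟩
    rw [dimAt_eq hQ]
    exact_mod_cast h Q hQ hK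

end Height

/-! ### Regular sequences in Cohen--Macaulay local rings -/

section CohenMacaulay

/-- The first `s` terms of `a` form a weakly regular sequence. -/
def IsRegularSeq {R : Type*} [CommRing R] (a : ℕ → R) (s : ℕ) : Prop :=
  ∀ i < s, ∀ x, a i * x ∈ spanLT a i → x ∈ spanLT a i

variable {R : Type u} [CommRing R]

lemma spanLT_congr {a b : ℕ → R} {i : ℕ} (h : ∀ j < i, a j = b j) : spanLT a i = spanLT b i := by
  rw [spanLT, spanLT, Set.image_congr (s := Set.Iio i) h]

lemma exists_isRegularSeq_of_idealGrade {I : Ideal R} {n : ℕ} (h : idealGrade I = n) :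
    ∃ y : ℕ → R, (∀ i < n, y i ∈ I) ∧ IsRegularSeq y n := by
  obtain rfl | hn := Nat.eq_zero_or_pos n
  · exact ⟨0, fun i hi => absurd hi (Nat.not_lt_zero _), fun i hi => absurd hi (Nat.not_lt_zero _)⟩
  rw [idealGrade] at h
  let S := {n : ℕ∞ | ∃ l : List R, (∀ x ∈ l, x ∈ I) ∧ RingTheory.Sequence.IsRegular R l ∧
    (l.length : ℕ∞) = n}
  have hne : Nonempty S := by
    by_contra hS
    rw [show sSup _ = sSup S from rfl, Set.not_nonempty_iff_eq_empty'.1 hS, sSup_empty,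
      bot_eq_zero] at h
    have : n = 0 := by exact_mod_cast h.symm
    omega
  have hlt : sSup S < ⊤ := h ▸ ENat.natCast_lt_top n
  obtain ⟨l, hl, hreg, hlen⟩ := ENat.sSup_mem_of_nonempty_of_lt_top hlt
  have hlen : l.length = n := by exact_mod_cast hlen.trans h
  refine ⟨fun i => l.getD i 0, fun i hi => ?_, fun i hi x hx => ?_⟩
  · simp only
    rw [List.getD_eq_getElem _ _ (by omega)]
    exact hl _ (List.getElem_mem _)
  · have hs : spanLT (fun i => l.getD i 0) i = Ideal.ofList (l.take i) := by
      rw [spanLT, Ideal.ofList]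
      congr 1
      ext z
      simp only [Set.mem_image, Set.mem_Iio, Set.mem_ofPred_eq, List.mem_take_iff_getElem]
      constructor
      · rintro ⟨j, hj, rfl⟩
        exact ⟨j, by omega, (List.getD_eq_getElem _ _ _).symm⟩
      · rintro ⟨j, hj, rfl⟩
        exact ⟨j, by omega, List.getD_eq_getElem _ _ _⟩
    have := hreg.regular_mod_prev i (by omega)
    simp only at hx
    rw [hs] at hx ⊢
    rw [List.getD_eq_getElem _ _ (by omega)] at hx
    have h0 : l[i] • (Submodule.Quotient.mk x :
        R ⧸ (Ideal.ofList (l.take i) • ⊤ : Submodule R R)) = l[i] • 0 := by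
      rw [smul_zero, ← Submodule.Quotient.mk_smul, Submodule.Quotient.mk_eq_zero]
      simpa using hx
    have := this h0
    rw [Submodule.Quotient.mk_eq_zero] at this
    simpa using this

variable [IsNoetherianRing R]

lemma le_natHeight_of_isRegularSeq {a : ℕ → R} {s : ℕ} (ha : IsRegularSeq a s) {i : ℕ}
    (hi : i ≤ s) {Q : Ideal R} (hQ : Q.IsPrime) (h : spanLT a i ≤ Q) : i ≤ natHeight Q := by
  induction i generalizing Q with
  | zero => omega
  | succ i ih =>
    obtain ⟨P, hP, hPQ⟩ := exists_isAssocTo_le_of_le hQ ((spanLT_mono a (Nat.le_succ i)).trans h)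
    have h1 := ih (by omega) hP.isPrime hP.le
    have h2 : a i ∉ P := hP.notMem_of_regular (ha i (by omega))
    have := natHeight_lt hP.isPrime hQ (hPQ.lt_of_ne (by
      rintro rfl
      exact h2 (h (mem_spanLT a (Nat.lt_succ_self i)))))
    omega

lemma le_natHeight_of_idealGrade {I : Ideal R} {n : ℕ} (h : idealGrade I = n) {Q : Ideal R}
    (hQ : Q.IsPrime) (hI : I ≤ Q) : n ≤ natHeight Q := by
  obtain ⟨y, hy, hreg⟩ := exists_isRegularSeq_of_idealGrade h
  exact le_natHeight_of_isRegularSeq hreg le_rfl hQ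
    ((spanLT_le_of_lt hy).trans hI)

variable [IsLocalRing R]

/-- All `Ext^j(k, R ⧸ K)` with `j < e` vanish. -/
def HasDepthGE (K : Ideal R) (e : ℕ) : Prop :=
  ∀ j < e, ∀ E : ExtMod R (R ⧸ maximalIdeal R) (R ⧸ K) j, E = 0

omit [IsNoetherianRing R] in
lemma HasDepthGE.sup_span {K : Ideal R} {e : ℕ} (h : HasDepthGE K (e + 1)) {y : R}
    (hy : ∀ x, y * x ∈ K → x ∈ K) : HasDepthGE (K ⊔ Ideal.span {y}) e := by
  intro j hj E
  obtain ⟨δ, -, h2, -⟩ := ExtMod.exists_quot_connecting hy (R ⧸ maximalIdeal R) j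
  exact h2 E (h (j + 1) (by omega) _) (h j (by omega))

omit [IsNoetherianRing R] in
lemma HasDepthGE.not_isAssocTo {K : Ideal R} {e : ℕ} (h : HasDepthGE K (e + 1)) :
    ¬ IsAssocTo K (maximalIdeal R) := by
  rintro ⟨-, x, hx⟩
  let φ : (R ⧸ maximalIdeal R) →ₗ[R] (R ⧸ K) :=
    Submodule.mapQ (maximalIdeal R) K (LinearMap.mulRight R x) fun r hr => (hx r).1 hr
  have h0 := h 0 (by omega) (ExtMod.ofLinearMap φ)
  rw [ExtMod.ofLinearMap_eq_zero_iff] at h0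
  have h1 : φ (Submodule.Quotient.mk 1) = 0 := by rw [h0]; rfl
  have h2 : φ (Submodule.Quotient.mk 1) = Submodule.Quotient.mk (1 * x) := rfl
  rw [h2, Submodule.Quotient.mk_eq_zero] at h1
  exact (Ideal.ne_top_iff_one _).1 (maximalIdeal.isMaximal R).ne_top ((hx 1).2 h1)

variable [Infinite (ResidueField R)]

lemma HasDepthGE.natHeight_add_le {K P : Ideal R} {e : ℕ} (h : HasDepthGE K e)
    (hP : IsAssocTo K P) : natHeight P + e ≤ natHeight (maximalIdeal R) := by
  have hm : (maximalIdeal R).IsPrime := inferInstance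
  induction e generalizing K P with
  | zero => exact natHeight_le hP.isPrime hm (le_maximalIdeal hP.isPrime.ne_top)
  | succ e ih =>
    obtain ⟨y, hy, hy'⟩ := exists_mem_forall_notMem (J := maximalIdeal R)
      (finite_setOf_isAssocTo K) fun P' (hP' : IsAssocTo K P') hle => h.not_isAssocTo
        (by rwa [hle.antisymm (le_maximalIdeal hP'.isPrime.ne_top)])
    have hreg := regular_of_notMem_isAssocTo fun P' hP' => hy' P' hP'
    obtain ⟨P', hP', hlt, -⟩ := exists_isAssocTo_sup_span hP hm
      (le_maximalIdeal hP.isPrime.ne_top) hy hreg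
    have h1 := ih (h.sup_span hreg) hP'
    have h2 := natHeight_lt hP.isPrime hP'.isPrime hlt
    omega

variable (hCM : IsCohenMacaulayLocalRing R)

include hCM in
omit [Infinite (ResidueField R)] in
lemma hasDepthGE_spanLT {a : ℕ → R} {s : ℕ} (ha : IsRegularSeq a s) {i : ℕ} (hi : i ≤ s) :
    HasDepthGE (spanLT a i) (natHeight (maximalIdeal R) - i) := by
  induction i with
  | zero =>
    have hgr : idealGrade (maximalIdeal R) = (natHeight (maximalIdeal R) : ℕ∞) := by
      have : (idealGrade (maximalIdeal R) : WithBot ℕ∞) = ringKrullDim R := hCM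
      rw [← maximalIdeal_height_eq_ringKrullDim] at this
      rw [coe_natHeight inferInstance]
      exact_mod_cast this
    obtain ⟨y, hy, hreg⟩ := exists_isRegularSeq_of_idealGrade hgr
    rw [spanLT_zero, ← spanLT_zero y]
    exact fun j hj E => ExtMod.eq_zero_of_regular hreg
      (fun i hi => ⟨1, fun x => by
        obtain ⟨x, rfl⟩ := Submodule.mkQ_surjective _ x
        rw [pow_one, ← map_smul, Submodule.mkQ_apply, Submodule.Quotient.mk_eq_zero]
        exact Ideal.mul_mem_right _ _ (hy i hi)⟩) (by omega) E
  | succ i ih =>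
    obtain h | h := Nat.eq_zero_or_pos (natHeight (maximalIdeal R) - i)
    · intro j hj
      omega
    · obtain ⟨e, he⟩ := Nat.exists_eq_succ_of_ne_zero h.ne'
      have := ih (by omega)
      rw [he] at this
      rw [spanLT_succ, show natHeight (maximalIdeal R) - (i + 1) = e by omega]
      exact this.sup_span (ha i (by omega))

include hCM in
/-- Unmixedness of ideals generated by regular sequences. -/
lemma natHeight_le_of_isAssocTo_spanLT {a : ℕ → R} {s : ℕ} (ha : IsRegularSeq a s) {i : ℕ}
    (hi : i ≤ s) {Q : Ideal R} (hQ : IsAssocTo (spanLT a i) Q) : natHeight Q ≤ i := by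
  have h1 := (hasDepthGE_spanLT hCM ha hi).natHeight_add_le hQ
  omega

include hCM in
lemma isRegularSeq_of_forall_notMem {K : Ideal R} {s : ℕ}
    (hK : ∀ Q : Ideal R, Q.IsPrime → K ≤ Q → s ≤ natHeight Q) {a : ℕ → R}
    (ha : ∀ i, ∀ e, IsAssocTo (spanLT a i) e → ¬ K ≤ e → a i ∉ e) : IsRegularSeq a s := by
  have key : ∀ i ≤ s, IsRegularSeq a i := by
    intro i
    induction i with
    | zero => exact fun _ i hi => absurd hi (Nat.not_lt_zero _)
    | succ i ih =>
      intro hi j hj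
      obtain h | rfl := Nat.lt_succ_iff_lt_or_eq.1 hj
      · exact ih (by omega) j h
      refine regular_of_notMem_isAssocTo fun P hP => ha j P hP fun hle => ?_
      have h1 := hK P hP.isPrime hle
      have h2 := natHeight_le_of_isAssocTo_spanLT hCM (ih (by omega)) le_rfl hP
      omega
  exact key s le_rfl

include hCM in
lemma exists_isRegularSeq {K : Ideal R} {s : ℕ}
    (hK : ∀ Q : Ideal R, Q.IsPrime → K ≤ Q → s ≤ natHeight Q) :
    ∃ y : ℕ → R, (∀ i, y i ∈ K) ∧ IsRegularSeq y s := by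
  obtain ⟨y, hy⟩ := exists_general_sequence K (fun K => {P | IsAssocTo K P})
    finite_setOf_isAssocTo
  exact ⟨y, fun i => (hy i).1, isRegularSeq_of_forall_notMem hCM hK fun i => (hy i).2⟩

include hCM in
/-- Saturated chains of primes: heights increase by at most one. -/
lemma natHeight_le_succ {P Q : Ideal R} (hP : P.IsPrime) (hQ : Q.IsPrime) (hPQ : P ≤ Q)
    (h : ∀ P' : Ideal R, P'.IsPrime → P < P' → P' ≤ Q → P' = Q) :
    natHeight Q ≤ natHeight P + 1 := by
  set i := natHeight P with hi
  obtain ⟨x, hx, hreg⟩ := exists_isRegularSeq hCM (K := P) (s := i)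
    fun Q hQ hle => natHeight_le hP hQ hle
  have hPA : IsAssocTo (spanLT x i) P := by
    obtain ⟨P', hP', hle⟩ := exists_isAssocTo_le_of_le hP (spanLT_le hx i)
    obtain rfl | hlt := hle.eq_or_lt
    · exact hP'
    · have h1 := natHeight_lt hP'.isPrime hP hlt
      have h2 := le_natHeight_of_isRegularSeq hreg le_rfl hP'.isPrime hP'.le
      omega
  by_cases hQA : ∃ e, IsAssocTo (spanLT x i) e ∧ Q ≤ e
  · obtain ⟨e, he, hle⟩ := hQA
    have h1 := natHeight_le hQ he.isPrime hle
    have h2 := natHeight_le_of_isAssocTo_spanLT hCM hreg le_rfl he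
    omega
  push Not at hQA
  obtain ⟨y, hyQ, hy⟩ := exists_mem_forall_notMem (finite_setOf_isAssocTo (spanLT x i)) hQA
  have hy := regular_of_notMem_isAssocTo hy
  obtain ⟨P', hP', hlt, hle⟩ := exists_isAssocTo_sup_span hPA hQ hPQ hyQ hy
  obtain rfl := h P' hP'.isPrime hlt hle
  let x' := Function.update x i y
  have hx' : ∀ j < i, x' j = x j := fun j hj => Function.update_of_ne hj.ne _ _
  have hs : ∀ j ≤ i, spanLT x' j = spanLT x j := fun j hj =>
    spanLT_congr fun k hk => hx' k (by omega)
  have hxi : x' i = y := Function.update_self _ _ _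
  refine natHeight_le_of_isAssocTo_spanLT hCM (a := x') (s := i + 1) (fun j hj => ?_) le_rfl ?_
  · rw [hs j (by omega)]
    obtain h | rfl := Nat.lt_succ_iff_lt_or_eq.1 hj
    · rw [hx' j h]
      exact hreg j h
    · rw [hxi]
      exact hy
  · rwa [spanLT_succ, hs i le_rfl, hxi]

end CohenMacaulay

/-! ### Serre's condition -/

section Serre

lemma idealGrade_le_one {A : Type*} [CommRing A] {m : Ideal A} {a z : A}
    (ha : ∀ x, a * x = 0 → x = 0) (hz : z ∉ Ideal.span {a}) (h : ∀ x ∈ m, x * z ∈ Ideal.span {a}) :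
    idealGrade m ≤ 1 := by
  refine sSup_le ?_
  rintro _ ⟨l, hl, hreg, rfl⟩
  match l, hl, hreg with
  | [], _, _ => simp
  | [_], _, _ => simp
  | x :: y :: l, hl, hreg =>
    exfalso
    have hreg := hreg.toIsWeaklyRegular
    rw [RingTheory.Sequence.isWeaklyRegular_cons_iff,
      RingTheory.Sequence.isWeaklyRegular_cons_iff] at hreg
    obtain ⟨hx, hy, -⟩ := hreg
    obtain ⟨w, hw⟩ := Ideal.mem_span_singleton.1 (h x (hl x (by simp)))
    obtain ⟨w', hw'⟩ := Ideal.mem_span_singleton.1 (h y (hl y (by simp)))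
    have h1 : x * w' = y * w := by
      refine sub_eq_zero.1 (ha _ ?_)
      linear_combination y * hw - x * hw'
    have hy0 : y • (Submodule.Quotient.mk w : QuotSMulTop x A) = y • 0 := by
      rw [smul_zero, ← Submodule.Quotient.mk_smul, Submodule.Quotient.mk_eq_zero,
        Submodule.mem_smul_pointwise_iff_exists]
      exact ⟨w', trivial, h1⟩
    have := hy hy0
    rw [Submodule.Quotient.mk_eq_zero, Submodule.mem_smul_pointwise_iff_exists] at this
    obtain ⟨t, -, rfl⟩ := this
    have h2 : x • z = x • (a * t) := by
      rw [smul_eq_mul, hw]; simp; ring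
    exact hz (Ideal.mem_span_singleton.2 ⟨t, hx h2⟩)

variable {R : Type u} [CommRing R]

lemma SerreS2.not_lt_lt {K : Ideal R} (hS : SerreS2 (R ⧸ K)) {a : R}
    (ha : ∀ x, a * x ∈ K → x ∈ K) {q : Ideal R} (hq : IsAssocTo (K ⊔ Ideal.span {a}) q)
    {P P' : Ideal R} (hP : P.IsPrime) (hP' : P'.IsPrime) (hKP : K ≤ P) (h1 : P < P')
    (h2 : P' < q) : False := by
  have hKP' := hKP.trans h1.le
  have hKq := hKP'.trans h2.le
  let π := Ideal.Quotient.mk K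
  have hπ : Function.Surjective π := Ideal.Quotient.mk_surjective
  have hprime : ∀ Q : Ideal R, Q.IsPrime → K ≤ Q → (Q.map π).IsPrime := fun Q hQ hle =>
    Ideal.map_isPrime_of_surjective hπ (by rwa [Ideal.mk_ker])
  have hmem : ∀ Q : Ideal R, K ≤ Q → ∀ x, π x ∈ Q.map π ↔ x ∈ Q := fun Q hle x =>
    Ideal.mem_quotient_iff_mem hle
  have hlt : ∀ Q Q' : Ideal R, K ≤ Q → Q < Q' → Q.map π < Q'.map π := fun Q Q' hle h => by
    refine SetLike.lt_iff_le_and_exists.2 ⟨Ideal.map_mono h.le, ?_⟩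
    obtain ⟨-, x, hx, hx'⟩ := SetLike.lt_iff_le_and_exists.1 h
    exact ⟨π x, (hmem Q' (hle.trans h.le) x).2 hx, fun h => hx' ((hmem Q hle x).1 h)⟩
  have hqp := hprime q hq.isPrime hKq
  have hPp := hprime P hP hKP
  have hPp' := hprime P' hP' hKP'
  have hht : (2 : ℕ∞) ≤ (q.map π).height := by
    have e1 := Ideal.height_add_one_le_of_lt_of_isPrime (hlt P P' hKP h1)
    have e2 := Ideal.height_add_one_le_of_lt_of_isPrime (hlt P' q hKP' h2)
    calc (2 : ℕ∞) = 0 + 1 + 1 := by norm_num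
      _ ≤ (P.map π).height + 1 + 1 := by gcongr; exact zero_le
      _ ≤ _ := le_trans (by gcongr) e2
  have hS := hS (q.map π) hqp
  let A := Localization.AtPrime (q.map π)
  have hmin : min (2 : WithBot ℕ∞) (ringKrullDim A) = 2 := by
    rw [IsLocalization.AtPrime.ringKrullDim_eq_height (q.map π), min_eq_left]
    exact WithBot.coe_le_coe.2 hht
  have hS : (2 : WithBot ℕ∞) ≤ (idealGrade (maximalIdeal A) : WithBot ℕ∞) := hmin ▸ hS
  obtain ⟨hqP, z, hz⟩ := hq
  have hle : idealGrade (maximalIdeal A) ≤ 1 := by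
    refine idealGrade_le_one (a := algebraMap (R ⧸ K) A (π a)) (z := algebraMap _ A (π z))
      ?_ ?_ ?_
    · intro x hx
      obtain ⟨x, s, rfl⟩ := IsLocalization.exists_mk'_eq (q.map π).primeCompl x
      rw [← IsLocalization.mk'_one (M := (q.map π).primeCompl) A (π a), ← IsLocalization.mk'_mul,
        IsLocalization.mk'_eq_zero_iff] at hx
      rw [IsLocalization.mk'_eq_zero_iff]
      obtain ⟨t, ht⟩ := hx
      refine ⟨t, ?_⟩
      obtain ⟨x, rfl⟩ := hπ x
      obtain ⟨t', ht'⟩ := hπ t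
      rw [← ht', ← map_mul, Ideal.Quotient.eq_zero_iff_mem]
      refine ha _ ?_
      rw [← Ideal.Quotient.eq_zero_iff_mem, ← ht, ← ht']
      simp only [π, map_mul]
      ring
    · intro h
      obtain ⟨b, hb⟩ := Ideal.mem_span_singleton.1 h
      obtain ⟨b, s, rfl⟩ := IsLocalization.exists_mk'_eq (q.map π).primeCompl b
      rw [IsLocalization.mul_mk'_eq_mk'_of_mul, IsLocalization.eq_mk'_iff_mul_eq,
        ← map_mul] at hb
      obtain ⟨t, ht⟩ := (IsLocalization.eq_iff_exists (q.map π).primeCompl A).1 hb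
      obtain ⟨b, rfl⟩ := hπ b
      obtain ⟨t', ht'⟩ := hπ t
      obtain ⟨s', hs'⟩ := hπ s
      rw [← ht', ← hs', ← map_mul, ← map_mul, ← map_mul, ← map_mul, Ideal.Quotient.eq] at ht
      have hts : t' * s' ∈ q := by
        rw [hz, mem_sup_span_singleton]
        exact ⟨_, ht, t' * b, by ring⟩
      have hs0 : s' ∉ q := fun h => s.2 (hs' ▸ (hmem q hKq s').2 h)
      have ht0 : t' ∉ q := fun h => t.2 (ht' ▸ (hmem q hKq t').2 h)
      exact hqP.mul_notMem ht0 hs0 hts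
    · intro x hx
      obtain ⟨x, s, rfl⟩ := IsLocalization.exists_mk'_eq (q.map π).primeCompl x
      rw [← IsLocalization.AtPrime.map_eq_maximalIdeal (q.map π) A,
        IsLocalization.mk'_mem_map_algebraMap_iff] at hx
      obtain ⟨t, ht, htx⟩ := hx
      obtain ⟨x, rfl⟩ := hπ x
      obtain ⟨t', rfl⟩ := hπ t
      rw [← map_mul, hmem q hKq] at htx
      have hxq : x ∈ q := (hqP.mem_or_mem htx).resolve_left
        fun h => ht ((hmem q hKq t').2 h)
      have := (hz x).1 hxq
      rw [mem_sup_span_singleton] at this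
      obtain ⟨k, hk, r, hr⟩ := this
      rw [mul_comm, IsLocalization.mul_mk'_eq_mk'_of_mul, mul_comm (π z), ← map_mul, hr, map_add,
        map_mul, Ideal.Quotient.eq_zero_iff_mem.2 hk, zero_add,
        ← IsLocalization.mul_mk'_eq_mk'_of_mul]
      exact Ideal.mul_mem_right _ _ (Ideal.mem_span_singleton_self _)
  have h3 : (2 : ℕ∞) ≤ 1 := le_trans (WithBot.coe_le_coe.1 hS) hle
  exact absurd h3 (by decide)

lemma SerreS2.natHeight_le [IsNoetherianRing R] [IsLocalRing R] [Infinite (ResidueField R)]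
    (hCM : IsCohenMacaulayLocalRing R) {K : Ideal R} (hS : SerreS2 (R ⧸ K)) {a : R}
    (ha : ∀ x, a * x ∈ K → x ∈ K) {q : Ideal R} (hq : IsAssocTo (K ⊔ Ideal.span {a}) q) {i : ℕ}
    (h : ∀ P, IsAssocTo K P → natHeight P ≤ i) : natHeight q ≤ i + 1 := by
  obtain ⟨P, hP, hPq⟩ := exists_isAssocTo_le_of_le hq.isPrime (le_sup_left.trans hq.le)
  refine (natHeight_le_succ hCM hP.isPrime hq.isPrime hPq fun P' hP' h1 h2 => ?_).trans
    (Nat.add_le_add_right (h P hP) 1)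
  by_contra hne
  exact hS.not_lt_lt ha hq hP.isPrime hP' hP.le h1 (h2.lt_of_ne hne)

end Serre

/-! ### Local numbers of generators -/

section LocalGenerators

variable {R : Type u} [CommRing R]

/-- The elements that are carried into `K` by some element outside `q`. -/
def satIdeal (K q : Ideal R) : Ideal R := Ideal.span {x | ∃ u ∉ q, u * x ∈ K}

lemma mem_satIdeal {K q : Ideal R} (hq : q.IsPrime) {x : R} :
    x ∈ satIdeal K q ↔ ∃ u ∉ q, u * x ∈ K := by
  refine ⟨fun h => ?_, fun h => Ideal.subset_span h⟩
  induction h using Submodule.span_induction with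
  | mem x h => exact h
  | zero => exact ⟨1, (Ideal.ne_top_iff_one q).1 hq.ne_top, by simp⟩
  | add x y _ _ hx hy =>
    obtain ⟨u, hu, hx⟩ := hx
    obtain ⟨v, hv, hy⟩ := hy
    refine ⟨u * v, hq.mul_notMem hu hv, ?_⟩
    have : u * v * (x + y) = v * (u * x) + u * (v * y) := by ring
    rw [this]
    exact K.add_mem (K.mul_mem_left _ hx) (K.mul_mem_left _ hy)
  | smul r x _ hx =>
    obtain ⟨u, hu, hx⟩ := hx
    refine ⟨u, hu, ?_⟩
    rw [smul_eq_mul, mul_left_comm]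
    exact K.mul_mem_left _ hx

/-- Locally at `q`, the ideal `I` is generated by `𝔞` and at most `k` further elements. -/
def LocGen (𝔞 I q : Ideal R) (k : ℕ) : Prop :=
  ∃ B : Finset R, B.card ≤ k ∧ (∀ b ∈ B, b ∈ I) ∧ ∃ u ∉ q, ∀ x ∈ I, u * x ∈ 𝔞 ⊔ Ideal.span B

lemma LocGen.mono {𝔞 𝔟 I q : Ideal R} {k l : ℕ} (h : LocGen 𝔞 I q k) (h𝔞 : 𝔞 ≤ 𝔟) (hk : k ≤ l) :
    LocGen 𝔟 I q l := by
  obtain ⟨B, hB, hBI, u, hu, h⟩ := h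
  exact ⟨B, hB.trans hk, hBI, u, hu, fun x hx => sup_le_sup_right h𝔞 _ (h x hx)⟩

lemma LocGen.exists_mul_mem {𝔞 I q : Ideal R} (h : LocGen 𝔞 I q 0) :
    ∃ u ∉ q, ∀ x ∈ I, u * x ∈ 𝔞 := by
  obtain ⟨B, hB, -, u, hu, h⟩ := h
  obtain rfl : B = ∅ := by simpa using hB
  exact ⟨u, hu, by simpa using h⟩

lemma LocGen.of_exists {𝔞 I q : Ideal R} (h : ∃ u ∉ q, ∀ x ∈ I, u * x ∈ 𝔞) (k : ℕ) :
    LocGen 𝔞 I q k := by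
  obtain ⟨u, hu, h⟩ := h
  exact ⟨∅, by simp, by simp, u, hu, by simpa using h⟩

lemma LocGen.sup_span {𝔞 I q : Ideal R} (hq : q.IsPrime) {k : ℕ} (h : LocGen 𝔞 I q (k + 1)) {a : R}
    (haI : a ∈ I) (ha : a ∉ satIdeal (𝔞 ⊔ q * I) q) : LocGen (𝔞 ⊔ Ideal.span {a}) I q k := by
  classical
  obtain ⟨B, hB, hBI, u, hu, h⟩ := h
  obtain ⟨α, hα, β, hβ, hab⟩ := Submodule.mem_sup.1 (h a haI)
  obtain ⟨c, -, hc⟩ := Submodule.mem_span_finset.1 hβ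
  obtain ⟨b₀, hb₀, hcb⟩ : ∃ b ∈ B, c b ∉ q := by
    by_contra! hall
    refine ha ((mem_satIdeal hq).2 ⟨u, hu, ?_⟩)
    rw [← hab, ← hc]
    exact Submodule.add_mem_sup hα
      (Ideal.sum_mem _ fun b hb => Ideal.mul_mem_mul (hall b hb) (hBI b hb))
  let L := (𝔞 ⊔ Ideal.span {a}) ⊔ Ideal.span (B.erase b₀ : Set R)
  have hBL : ∀ b ∈ B, b ≠ b₀ → b ∈ L := fun b hb hne =>
    Ideal.mem_sup_right (Ideal.subset_span (by simp [hb, hne]))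
  have hb₀L : c b₀ * b₀ ∈ L := by
    have : c b₀ * b₀ = u * a - α - ∑ b ∈ B.erase b₀, c b • b := by
      rw [← hab, ← hc, ← Finset.add_sum_erase _ _ hb₀, smul_eq_mul]
      ring
    rw [this]
    refine L.sub_mem (L.sub_mem ?_ ?_) (L.sum_mem fun b hb => ?_)
    · exact L.mul_mem_left _ (Ideal.mem_sup_left
        (Ideal.mem_sup_right (Ideal.mem_span_singleton_self a)))
    · exact Ideal.mem_sup_left (Ideal.mem_sup_left hα)
    · exact L.mul_mem_left _ (hBL b (Finset.mem_of_mem_erase hb) (Finset.ne_of_mem_erase hb))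
  refine ⟨B.erase b₀, ?_, fun b hb => hBI b (Finset.mem_of_mem_erase hb), c b₀ * u,
    hq.mul_notMem hcb hu, fun x hx => ?_⟩
  · rw [Finset.card_erase_of_mem hb₀]
    omega
  · obtain ⟨α', hα', β', hβ', hab'⟩ := Submodule.mem_sup.1 (h x hx)
    obtain ⟨d, -, hd⟩ := Submodule.mem_span_finset.1 hβ'
    rw [mul_assoc, ← hab', ← hd, mul_add, Finset.mul_sum]
    refine L.add_mem (L.mul_mem_left _ (Ideal.mem_sup_left (Ideal.mem_sup_left hα')))
      (L.sum_mem fun b hb => ?_)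
    by_cases hbb : b = b₀
    · subst hbb
      rw [smul_eq_mul, mul_left_comm]
      exact L.mul_mem_left _ hb₀L
    · exact L.mul_mem_left _ (L.mul_mem_left _ (hBL b hb hbb))

/-- The ideal defining the locus where `I` is not generated by `𝔞` and `k` further elements. -/
def locGenIdeal (𝔞 I : Ideal R) (k : ℕ) : Ideal R :=
  ⨆ (B : Finset R) (_ : B.card ≤ k ∧ ∀ b ∈ B, b ∈ I),
    Submodule.colon (𝔞 ⊔ Ideal.span (B : Set R)) (I : Set R)

lemma locGenIdeal_le_iff {𝔞 I q : Ideal R} {k : ℕ} : locGenIdeal 𝔞 I k ≤ q ↔ ¬ LocGen 𝔞 I q k := by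
  rw [locGenIdeal, iSup₂_le_iff]
  constructor
  · rintro h ⟨B, hB, hBI, u, hu, hx⟩
    exact hu (h B ⟨hB, hBI⟩ (mem_colon_ideal.2 hx))
  · intro h B hB u hu
    by_contra hq
    exact h ⟨B, hB.1, hB.2, u, hq, mem_colon_ideal.1 hu⟩

lemma IdealGs.locGen [IsNoetherianRing R] {I : Ideal R} {ℓ : ℕ} (h : IdealGs I ℓ) {q : Ideal R}
    (hq : q.IsPrime) (hI : I ≤ q) (hql : natHeight q < ℓ) : LocGen ⊥ I q (natHeight q) := by
  classical
  have h := h q hq hI (by rw [dimAt_eq hq]; exact_mod_cast hql)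
  rw [dimAt_eq hq, WithBot.coe_le_coe] at h
  let A := Localization.AtPrime q
  set S := {n : ℕ∞ | ∃ s : Finset (I.map (algebraMap R A)), (s.card : ℕ∞) = n ∧
    Submodule.span A (s : Set (I.map (algebraMap R A))) = ⊤} with hS
  have hne : S.Nonempty := by
    by_contra hne
    rw [mu, ← hS, Set.not_nonempty_iff_eq_empty.1 hne, sInf_empty] at h
    exact absurd h (by simp)
  obtain ⟨s, hs, hspan⟩ := csInf_mem hne
  have hcard : s.card ≤ natHeight q := by
    have : (s.card : ℕ∞) ≤ natHeight q := hs ▸ h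
    exact_mod_cast this
  have hrep : ∀ z : I.map (algebraMap R A), ∃ b ∈ I, ∃ u ∈ q.primeCompl,
      algebraMap R A u * z = algebraMap R A b := by
    rintro ⟨z, hz⟩
    obtain ⟨⟨b, u⟩, hbu⟩ := (IsLocalization.mem_map_algebraMap_iff q.primeCompl A).1 hz
    exact ⟨b, b.2, u, u.2, by rw [mul_comm]; exact hbu⟩
  choose b hbI u hu hbu using hrep
  refine ⟨s.image b, Finset.card_image_le.trans hcard, ?_, ?_⟩
  · simp only [Finset.mem_image]
    rintro _ ⟨z, -, rfl⟩
    exact hbI z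
  · refine exists_uniform hq fun x hx => ?_
    let L : Ideal R := Ideal.span (s.image b : Set R)
    have key : ∀ z : I.map (algebraMap R A), (z : A) ∈ L.map (algebraMap R A) := by
      intro z
      have hz : z ∈ Submodule.span A (s : Set (I.map (algebraMap R A))) := hspan ▸ trivial
      induction hz using Submodule.span_induction with
      | mem z hz =>
        have h1 : algebraMap R A (u z) * z ∈ L.map (algebraMap R A) := by
          rw [hbu]
          exact Ideal.mem_map_of_mem _ (Ideal.subset_span (by
            rw [Finset.coe_image]; exact ⟨z, hz, rfl⟩))
        exact (Ideal.unit_mul_mem_iff_mem _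
          (IsLocalization.map_units A (⟨u z, hu z⟩ : q.primeCompl))).1 h1
      | zero => exact Ideal.zero_mem _
      | add y z _ _ hy hz => exact Ideal.add_mem _ hy hz
      | smul r z _ hz => exact Ideal.mul_mem_left _ r hz
    have := key ⟨algebraMap R A x, Ideal.mem_map_of_mem _ hx⟩
    obtain ⟨v, hv, hvx⟩ :=
      (IsLocalization.algebraMap_mem_map_algebraMap_iff q.primeCompl A L x).1 this
    exact ⟨v, hv, Ideal.mem_sup_right hvx⟩

end LocalGenerators

/-! ### General sequences of elements in a reduction -/

section GeneralSequence

variable {R : Type u} [CommRing R]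

lemma IsReduction.le_of_le {J I q : Ideal R} (h : IsReduction J I) (hq : q.IsPrime) (hJ : J ≤ q) :
    I ≤ q := by
  obtain ⟨-, N, hN⟩ := h
  refine hq.le_of_pow_le (n := N + 1) ?_
  rw [hN]
  exact Ideal.mul_le_left.trans hJ

/-- Elements of `J` chosen successively outside all the finitely many ideals that matter for
residual intersections of `I`. -/
structure IsGeneralSeq (I J : Ideal R) (ℓ : ℕ) (a : ℕ → R) : Prop where
  mem : ∀ i, a i ∈ J
  notMem : ∀ i e, IsAssocTo (spanLT a i) e → ¬ J ≤ e → a i ∉ e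
  notMem_colon : ∀ i e, IsAssocTo (Submodule.colon (spanLT a i) (I : Set R)) e → ¬ J ≤ e → a i ∉ e
  notMem_sat : ∀ i, ∀ k < ℓ, ∀ q ∈ (I ⊔ locGenIdeal (spanLT a i) I k).minimalPrimes,
    ¬ J ≤ satIdeal (spanLT a i ⊔ q * I) q → a i ∉ satIdeal (spanLT a i ⊔ q * I) q

lemma exists_isGeneralSeq [IsNoetherianRing R] [IsLocalRing R] [Infinite (ResidueField R)]
    (I J : Ideal R) (ℓ : ℕ) (E : Ideal R → Set (Ideal R)) (hE : ∀ K, (E K).Finite) :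
    ∃ a : ℕ → R, IsGeneralSeq I J ℓ a ∧ ∀ i, ∀ e ∈ E (spanLT a i), ¬ J ≤ e → a i ∉ e := by
  obtain ⟨a, ha⟩ := exists_general_sequence J
    (fun K => {e | IsAssocTo K e} ∪ {e | IsAssocTo (Submodule.colon K (I : Set R)) e} ∪
      (⋃ k ∈ Set.Iio ℓ, (fun q => satIdeal (K ⊔ q * I) q) ''
        (I ⊔ locGenIdeal K I k).minimalPrimes) ∪ E K)
    (fun K => (((finite_setOf_isAssocTo K).union (finite_setOf_isAssocTo _)).union
      ((Set.finite_Iio ℓ).biUnion fun k _ =>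
        (Ideal.finite_minimalPrimes_of_isNoetherianRing R _).image _)).union (hE K))
  refine ⟨a, ⟨fun i => (ha i).1, fun i e he => (ha i).2 e ?_, fun i e he => (ha i).2 e ?_,
    fun i k hk q hq => (ha i).2 _ ?_⟩, fun i e he => (ha i).2 e (Or.inr he)⟩
  · exact Or.inl (Or.inl (Or.inl he))
  · exact Or.inl (Or.inl (Or.inr he))
  · exact Or.inl (Or.inr (Set.mem_biUnion (Set.mem_Iio.2 hk) ⟨q, hq, rfl⟩))

variable {I J : Ideal R} {ℓ s g : ℕ} {a : ℕ → R}

namespace IsGeneralSeq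

lemma spanLT_le_left (ha : IsGeneralSeq I J ℓ a) (i : ℕ) : spanLT a i ≤ J := spanLT_le ha.mem i

variable [IsNoetherianRing R]

lemma le_natHeight (ha : IsGeneralSeq I J ℓ a) (hJ : IsReduction J I) {q : Ideal R} (hq : q.IsPrime)
    (hI : ¬ I ≤ q) {i : ℕ} (hi : spanLT a i ≤ q) : i ≤ natHeight q := by
  induction i generalizing q with
  | zero => omega
  | succ i ih =>
    have hle := (spanLT_mono a (Nat.le_succ i)).trans hi
    by_contra h2
    have hPA : IsAssocTo (spanLT a i) q := by
      refine isAssocTo_of_minimal hq hle fun P hP hle' hPq => hPq.eq_or_lt.resolve_right ?_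
      intro hlt
      have h1 := ih hP (fun h => hI (h.trans hPq)) hle'
      have := natHeight_lt hP hq hlt
      omega
    exact ha.notMem i q hPA (fun h => hI (hJ.le_of_le hq h))
      (hi (mem_spanLT a (Nat.lt_succ_self i)))

lemma locGen (ha : IsGeneralSeq I J ℓ a) (hJ : IsReduction J I) (hG : IdealGs I ℓ) (hs : s ≤ ℓ)
    (hc : ∀ q : Ideal R, q.IsPrime → Submodule.colon J (I : Set R) ≤ q → s ≤ natHeight q)
    (i : ℕ) {q : Ideal R} (hq : q.IsPrime) (hI : I ≤ q) (hqs : natHeight q < s) :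
    LocGen (spanLT a i) I q (natHeight q - i) := by
  induction i generalizing q with
  | zero => exact (hG.locGen hq hI (by omega)).mono bot_le (by omega)
  | succ i ih =>
    have hmono := spanLT_mono a (Nat.le_succ i)
    have hi := ih hq hI hqs
    obtain h0 | h0 := Nat.eq_zero_or_pos (natHeight q - i)
    · exact hi.mono hmono (by omega)
    obtain ⟨k, hk⟩ := Nat.exists_eq_succ_of_ne_zero h0.ne'
    rw [show natHeight q - (i + 1) = k by omega]
    rw [hk] at hi
    by_cases hL : LocGen (spanLT a i) I q k
    · exact hL.mono hmono le_rfl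
    have hmin : q ∈ (I ⊔ locGenIdeal (spanLT a i) I k).minimalPrimes := by
      refine ⟨⟨hq, sup_le hI (locGenIdeal_le_iff.2 hL)⟩, fun q' hq' hle => ?_⟩
      obtain rfl | hlt := hle.eq_or_lt
      · rfl
      exfalso
      have hlt' := natHeight_lt hq'.1 hq hlt
      exact locGenIdeal_le_iff.1 (le_sup_right.trans hq'.2)
        ((ih hq'.1 (le_sup_left.trans hq'.2) (by omega)).mono le_rfl (by omega))
    rw [spanLT_succ]
    refine hi.sup_span hq (hJ.1 (ha.mem i)) (ha.notMem_sat i k (by omega) q hmin fun hle => hL ?_)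
    refine LocGen.of_exists (exists_mul_mem_of_mul_mem_sup hq ?_) k
    obtain ⟨v, hv, hvq⟩ := SetLike.not_le_iff_exists.1
      fun h : Submodule.colon J (I : Set R) ≤ q => absurd (hc q hq h) (by omega)
    refine exists_uniform hq fun x hx => ?_
    obtain ⟨u, hu, hux⟩ := (mem_satIdeal hq).1 (hle (mem_colon_ideal.1 hv x hx))
    exact ⟨u * v, hq.mul_notMem hu hvq, by rwa [mul_assoc]⟩

lemma lt_natHeight (ha : IsGeneralSeq I J ℓ a) (hJ : IsReduction J I) (hG : IdealGs I ℓ)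
    (hs : s ≤ ℓ)
    (hc : ∀ q : Ideal R, q.IsPrime → Submodule.colon J (I : Set R) ≤ q → s ≤ natHeight q)
    {i : ℕ} (hi : i < s) {q : Ideal R} (hq : q.IsPrime) (hI : I ≤ q)
    (hK : Submodule.colon (spanLT a i) (I : Set R) ≤ q) : i < natHeight q := by
  by_contra hlt
  have h := ha.locGen hJ hG hs hc i hq hI (by omega)
  rw [show natHeight q - i = 0 by omega] at h
  obtain ⟨u, hu, h⟩ := h.exists_mul_mem
  exact hu (hK (mem_colon_ideal.2 h))

lemma isGeometricResidualIntersection (ha : IsGeneralSeq I J ℓ a) (hJ : IsReduction J I)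
    (hJI : J ≠ I) (hG : IdealGs I ℓ) (hs : s ≤ ℓ)
    (hc : ∀ q : Ideal R, q.IsPrime → Submodule.colon J (I : Set R) ≤ q → s ≤ natHeight q)
    {i : ℕ} (hi : i < s) : IsGeometricResidualIntersection I (spanLT a i) i := by
  refine ⟨⟨(ha.spanLT_le_left i).trans hJ.1, ⟨fun j => a j, ?_⟩, fun htop => hJI ?_, ?_⟩, ?_⟩
  · rw [spanLT]
    congr 1
    ext x
    simp only [Set.mem_range, Set.mem_image, Set.mem_Iio]
    exact ⟨fun ⟨j, hj⟩ => ⟨j, j.2, hj⟩, fun ⟨j, hj, h⟩ => ⟨⟨j, hj⟩, h⟩⟩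
  · refine le_antisymm hJ.1 fun x hx => ha.spanLT_le_left i ?_
    simpa using mem_colon_ideal.1 (htop ▸ trivial : (1 : R) ∈ _) x hx
  · rw [natCast_le_idealHeight]
    intro q hq hle
    by_cases hI : I ≤ q
    · exact (ha.lt_natHeight hJ hG hs hc hi hq hI hle).le
    · exact ha.le_natHeight hJ hq hI
        (le_trans (fun x hx => mem_colon_ideal.2 fun b _ => Ideal.mul_mem_right _ _ hx) hle)
  · rw [natCast_le_idealHeight]
    intro q hq hle
    exact ha.lt_natHeight hJ hG hs hc hi hq (le_sup_left.trans hle) (le_sup_right.trans hle)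

lemma regular_colon (ha : IsGeneralSeq I J ℓ a) (hJ : IsReduction J I) (hG : IdealGs I ℓ)
    (hs : s ≤ ℓ)
    (hc : ∀ q : Ideal R, q.IsPrime → Submodule.colon J (I : Set R) ≤ q → s ≤ natHeight q)
    {i : ℕ} (hi : i < s)
    (hK : ∀ P, IsAssocTo (Submodule.colon (spanLT a i) (I : Set R)) P → natHeight P ≤ i) {x : R}
    (hx : a i * x ∈ Submodule.colon (spanLT a i) (I : Set R)) :
    x ∈ Submodule.colon (spanLT a i) (I : Set R) :=
  regular_of_notMem_isAssocTo (fun P hP => ha.notMem_colon i P hP fun hle => absurd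
    (ha.lt_natHeight hJ hG hs hc hi hP.isPrime (hJ.le_of_le hP.isPrime hle) hP.le)
    (hK P hP).not_gt) x hx

variable [IsLocalRing R] [Infinite (ResidueField R)] (hCM : IsCohenMacaulayLocalRing R)

include hCM in
lemma isRegularSeq (ha : IsGeneralSeq I J ℓ a) (hJ : IsReduction J I) (hg : idealGrade I = g) :
    IsRegularSeq a g :=
  isRegularSeq_of_forall_notMem hCM (K := J)
    (fun _ hQ hle => le_natHeight_of_idealGrade hg hQ (hJ.le_of_le hQ hle)) ha.notMem

include hCM in
lemma residual (ha : IsGeneralSeq I J ℓ a) (hJ : IsReduction J I) (hJI : J ≠ I)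
    (hG : IdealGs I ℓ) (hg : idealGrade I = g) (hS2 : WeaklyResiduallyS2Lt I g ℓ) (hs : s ≤ ℓ)
    (hc : ∀ q : Ideal R, q.IsPrime → Submodule.colon J (I : Set R) ≤ q → s ≤ natHeight q)
    {i : ℕ} (hi : i ≤ s) :
    (i < s → ∀ x ∈ I, x ∈ Submodule.colon (spanLT a i) (I : Set R) → x ∈ spanLT a i) ∧
      ∀ P, IsAssocTo (Submodule.colon (spanLT a i) (I : Set R)) P → natHeight P ≤ i := by
  have hreg := ha.isRegularSeq hCM hJ hg
  have key {K : Ideal R} {i : ℕ} (hi : i < s) (haK : spanLT a i ≤ K)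
      (hK : ∀ P, IsAssocTo K P → natHeight P ≤ i) {x : R} (hx : x ∈ I)
      (hxK : x ∈ Submodule.colon (spanLT a i) (I : Set R)) : x ∈ K := by
    refine mem_of_isAssocTo fun Q hQ => ?_
    by_cases hI : I ≤ Q
    · obtain ⟨v, hv, hvQ⟩ := SetLike.not_le_iff_exists.1
        fun h : Submodule.colon (spanLT a i) (I : Set R) ≤ Q =>
          absurd (ha.lt_natHeight hJ hG hs hc hi hQ.isPrime hI h) (hK Q hQ).not_gt
      exact ⟨v, hvQ, haK (mem_colon_ideal.1 hv x hx)⟩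
    · obtain ⟨b, hb, hbQ⟩ := SetLike.not_le_iff_exists.1 hI
      exact ⟨b, hbQ, haK (mul_comm x b ▸ mem_colon_ideal.1 hxK b hb)⟩
  have hsmall {i : ℕ} (hig : i ≤ g) {P : Ideal R} (hP : IsAssocTo (spanLT a i) P) :
      natHeight P ≤ i := natHeight_le_of_isAssocTo_spanLT hCM hreg hig hP
  induction i with
  | zero => exact ⟨fun h x hx hxK => key h le_rfl (fun P => hsmall (Nat.zero_le _)) hx hxK,
      fun P hP => hsmall (Nat.zero_le _) hP.colon⟩
  | succ i ih =>
    by_cases hig : i + 1 ≤ g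
    · exact ⟨fun h x hx hxK => key h le_rfl (fun P => hsmall hig) hx hxK,
        fun P hP => hsmall hig hP.colon⟩
    obtain ⟨h1, h2⟩ := ih (by omega)
    have h1 := h1 (by omega)
    set K := Submodule.colon (spanLT a i) (I : Set R) with hKdef
    have haK : spanLT a i ≤ K := fun x hx => mem_colon_ideal.2 fun b _ => Ideal.mul_mem_right _ _ hx
    have hai : ∀ x, a i * x ∈ K → x ∈ K := fun x =>
      ha.regular_colon hJ hG hs hc (by omega) h2
    have hS := hS2 i (by omega) (by omega) _
      (ha.isGeometricResidualIntersection hJ hJI hG hs hc (i := i) (by omega))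
    have hle : spanLT a (i + 1) ≤ K ⊔ Ideal.span {a i} := by
      rw [spanLT_succ]
      exact sup_le_sup_right haK _
    have hback : ∀ x ∈ I, x ∈ K ⊔ Ideal.span {a i} → x ∈ spanLT a (i + 1) := by
      intro x hx hxK
      obtain ⟨k, hk, r, rfl⟩ := mem_sup_span_singleton.1 hxK
      have har : a i * r ∈ I := I.mul_mem_right _ (hJ.1 (ha.mem i))
      have hkI : k ∈ I := by simpa using I.sub_mem hx har
      exact Ideal.add_mem _ (spanLT_mono a (Nat.le_succ i) (h1 k hkI hk))
        (Ideal.mul_mem_right _ _ (mem_spanLT a (Nat.lt_succ_self i)))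
    have hass : ∀ P, IsAssocTo (K ⊔ Ideal.span {a i}) P → natHeight P ≤ i + 1 := fun P hP =>
      hS.natHeight_le hCM hai hP h2
    have hcol : Submodule.colon (spanLT a (i + 1)) (I : Set R) =
        Submodule.colon (K ⊔ Ideal.span {a i}) (I : Set R) := by
      ext y
      rw [mem_colon_ideal, mem_colon_ideal]
      exact ⟨fun h b hb => hle (h b hb), fun h b hb => hback _ (I.mul_mem_left _ hb) (h b hb)⟩
    refine ⟨fun hlt x hx hxK => hback x hx (key hlt hle hass hx hxK), fun P hP => ?_⟩
    rw [hcol] at hP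
    exact hass P hP.colon

end IsGeneralSeq

end GeneralSequence

section HeightOfColon

variable {R : Type u} [CommRing R] [IsNoetherianRing R] [IsLocalRing R] [Infinite (ResidueField R)]

/-- A proper reduction `J` of an ideal `I` satisfying `G_ℓ` and weakly residually `S_2` has
`J : I` of height at least `ℓ`. -/
lemma IsReduction.le_natHeight_of_colon_le (hCM : IsCohenMacaulayLocalRing R) {I J : Ideal R}
    {g ℓ : ℕ} (hJ : IsReduction J I) (hJI : J ≠ I) (hG : IdealGs I ℓ) (hg : idealGrade I = g)
    (hS2 : WeaklyResiduallyS2Lt I g ℓ) {q : Ideal R} (hq : q.IsPrime)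
    (hcq : Submodule.colon J (I : Set R) ≤ q) : ℓ ≤ natHeight q := by
  induction hn : natHeight q using Nat.strong_induction_on generalizing q with
  | _ t ih =>
    by_contra! htℓ
    have hc : ∀ p : Ideal R, p.IsPrime → Submodule.colon J (I : Set R) ≤ p → t ≤ natHeight p := by
      intro p hp hcp
      by_contra! hlt
      have := ih _ hlt hp hcp rfl
      omega
    have hJc : J ≤ Submodule.colon J (I : Set R) := fun x hx =>
      mem_colon_ideal.2 fun b _ => Ideal.mul_mem_right _ _ hx
    have hIq : I ≤ q := hJ.le_of_le hq (hJc.trans hcq)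
    obtain ⟨a, ha, hsat⟩ := exists_isGeneralSeq I J ℓ (fun K => {satIdeal (K ⊔ q * I) q})
      fun K => Set.finite_singleton _
    replace hsat : ∀ i, ¬ J ≤ satIdeal (spanLT a i ⊔ q * I) q →
        a i ∉ satIdeal (spanLT a i ⊔ q * I) q := fun i => hsat i _ rfl
    by_cases hall : ∀ i < t, ¬ J ≤ satIdeal (spanLT a i ⊔ q * I) q
    · have hgen : ∀ i ≤ t, LocGen (spanLT a i) I q (t - i) := by
        intro i hi
        induction i with
        | zero => exact (hn ▸ hG.locGen hq hIq (by omega)).mono bot_le le_rfl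
        | succ i ih' =>
          rw [spanLT_succ]
          refine LocGen.sup_span hq ?_ (hJ.1 (ha.mem i)) (hsat i (hall i (by omega)))
          rw [show t - (i + 1) + 1 = t - i by omega]
          exact ih' (by omega)
      have := hgen t le_rfl
      rw [Nat.sub_self] at this
      obtain ⟨u, hu, hux⟩ := this.exists_mul_mem
      exact hu (hcq (mem_colon_ideal.2 fun x hx => ha.spanLT_le_left t (hux x hx)))
    · push Not at hall
      obtain ⟨i, hi, hle⟩ := hall
      obtain ⟨k, rfl⟩ : ∃ k, t = k + 1 := ⟨t - 1, by omega⟩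
      set A := spanLT a k with hA
      have hmono : ∀ x ∈ J, ∃ u ∉ q, u * x ∈ A ⊔ q * I := fun x hx => by
        obtain ⟨u, hu, hux⟩ := (mem_satIdeal hq).1 (hle hx)
        exact ⟨u, hu, sup_le_sup_right (spanLT_mono a (by omega)) _ hux⟩
      obtain ⟨u, hu, hux⟩ := exists_uniform hq hmono
      obtain ⟨N, hN⟩ := hJ.2
      have hpow : ∀ x ∈ I ^ (N + 1), u * x ∈ A ⊔ q * I ^ (N + 1) := by
        suffices h : ∀ x ∈ J * I ^ N, u * x ∈ A ⊔ q * I ^ (N + 1) from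
          fun x hx => h x (hN ▸ hx)
        intro x hx
        induction hx using Submodule.mul_induction_on' with
        | mem_mul_mem y hy z hz =>
          rw [← mul_assoc]
          have : u * y * z ∈ (A ⊔ q * I) * I ^ N := Ideal.mul_mem_mul (hux y hy) hz
          rw [Ideal.sup_mul, mul_assoc, ← pow_succ'] at this
          exact sup_le_sup_right (Ideal.mul_le_left (I := A) (J := I ^ N)) _ this
        | add y _ z _ hy hz =>
          rw [mul_add]
          exact Ideal.add_mem _ hy hz
      obtain ⟨v, hv, hvx⟩ := exists_mul_mem_of_mul_mem_sup hq ⟨u, hu, hpow⟩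
      set K := Submodule.colon A (I : Set R) with hK
      have hAK : A ≤ K := fun x hx => mem_colon_ideal.2 fun b _ => Ideal.mul_mem_right _ _ hx
      have hKq : K ≤ q := fun x hx =>
        hcq (mem_colon_ideal.2 fun b hb => ha.spanLT_le_left k (mem_colon_ideal.1 hx b hb))
      obtain ⟨P, hP, hPq⟩ := exists_isAssocTo_le_of_le hq hKq
      have hPk := (ha.residual hCM hJ hJI hG hg hS2 htℓ.le hc (i := k) (by omega)).2 P hP
      have hIP : I ≤ P := by
        refine hP.isPrime.le_of_pow_le (n := N + 1) fun x hx => ?_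
        exact (hP.isPrime.mem_or_mem (hP.le (hAK (hvx x hx)))).resolve_left fun h => hv (hPq h)
      have := ha.lt_natHeight hJ hG htℓ.le hc (i := k) (by omega) hP.isPrime hIP hP.le
      omega

end HeightOfColon

/-! ### Generating a minimal reduction by a general sequence -/

section ReesAlgebra

open Polynomial

variable {R : Type u} [CommRing R]

/-- The ideal of the Rees algebra generated by the degree one copy of `K`. -/
def degOne (I K : Ideal R) : Ideal (reesAlgebra I) :=
  Ideal.span {p | ∃ x ∈ K, (p : R[X]) = monomial 1 x}

/-- The elements whose degree one copy lies in `P`. -/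
def degOneComap {I : Ideal R} (P : Ideal (reesAlgebra I)) : Ideal R where
  carrier := {x | ∃ p ∈ P, (p : R[X]) = monomial 1 x}
  zero_mem' := ⟨0, P.zero_mem, by simp⟩
  add_mem' := by
    rintro x y ⟨p, hp, hpx⟩ ⟨q, hq, hqy⟩
    exact ⟨p + q, P.add_mem hp hq, by simp [hpx, hqy]⟩
  smul_mem' := by
    rintro r x ⟨p, hp, hpx⟩
    exact ⟨r • p, by rw [Algebra.smul_def]; exact P.mul_mem_left _ hp, by simp [hpx, smul_monomial]⟩

lemma degOne_le_iff {I K : Ideal R} (hK : K ≤ I) {P : Ideal (reesAlgebra I)} :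
    degOne I K ≤ P ↔ K ≤ degOneComap P := by
  rw [degOne, Ideal.span_le]
  constructor
  · intro h x hx
    have hxI : monomial 1 x ∈ reesAlgebra I := reesAlgebra.monomial_mem.2 (by simpa using hK hx)
    exact ⟨⟨_, hxI⟩, h ⟨x, hx, rfl⟩, rfl⟩
  · rintro h p ⟨x, hx, hpx⟩
    obtain ⟨q, hq, hqx⟩ := h hx
    rwa [SetLike.mem_coe, Subtype.ext (hpx.trans hqx.symm)]

lemma degOne_mono {I K L : Ideal R} (h : K ≤ L) : degOne I K ≤ degOne I L :=
  Ideal.span_mono fun _ ⟨x, hx, hpx⟩ => ⟨x, h hx, hpx⟩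

/-- The elements of the Rees algebra whose constant coefficient lies in the maximal ideal. -/
def reesMaximal [IsLocalRing R] (I : Ideal R) : Ideal (reesAlgebra I) :=
  (maximalIdeal R).comap (constantCoeff.comp (reesAlgebra I).val.toRingHom)

instance [IsLocalRing R] (I : Ideal R) : (reesMaximal I).IsPrime := Ideal.comap_isPrime _ _

lemma mem_reesMaximal [IsLocalRing R] {I : Ideal R} {f : reesAlgebra I} :
    f ∈ reesMaximal I ↔ (f : R[X]).coeff 0 ∈ maximalIdeal R := Iff.rfl

lemma degOne_le_reesMaximal [IsLocalRing R] (I K : Ideal R) : degOne I K ≤ reesMaximal I := by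
  rw [degOne, Ideal.span_le]
  rintro p ⟨x, -, hpx⟩
  rw [SetLike.mem_coe, mem_reesMaximal, hpx]
  simp [coeff_monomial]

lemma map_le_reesMaximal [IsLocalRing R] (I : Ideal R) :
    (maximalIdeal R).map (algebraMap R (reesAlgebra I)) ≤ reesMaximal I := by
  rw [Ideal.map_le_iff_le_comap]
  intro r hr
  rw [Ideal.mem_comap, mem_reesMaximal]
  simpa using hr

/-- The elements of the Rees algebra whose coefficients lie in given ideals. -/
def reesCoeffIdeal (I : Ideal R) (L : ℕ → Ideal R) (hL : ∀ j k, I ^ j * L k ≤ L (j + k)) :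
    Ideal (reesAlgebra I) where
  carrier := {f | ∀ k, (f : R[X]).coeff k ∈ L k}
  zero_mem' k := by simp
  add_mem' hf hg k := by simpa using Ideal.add_mem _ (hf k) (hg k)
  smul_mem' c f hf k := by
    simp only [smul_eq_mul, MulMemClass.coe_mul, coeff_mul]
    refine Ideal.sum_mem _ fun x hx => ?_
    rw [← Finset.HasAntidiagonal.mem_antidiagonal.1 hx]
    exact hL _ _ (Ideal.mul_mem_mul (c.2 _) (hf _))

lemma coeff_mem_of_mem_sup {I K 𝔪 : Ideal R} {f : reesAlgebra I}
    (hf : f ∈ 𝔪.map (algebraMap R (reesAlgebra I)) ⊔ degOne I K) (k : ℕ) :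
    (f : R[X]).coeff (k + 1) ∈ 𝔪 * I ^ (k + 1) ⊔ K * I ^ k := by
  let L : ℕ → Ideal R := fun k => Nat.casesOn k 𝔪 fun k => 𝔪 * I ^ (k + 1) ⊔ K * I ^ k
  have hL : ∀ j k, I ^ j * L k ≤ L (j + k) := by
    rintro j (_ | k)
    · cases j with
      | zero => simp [L]
      | succ j => exact (mul_comm (I ^ (j + 1)) 𝔪).le.trans le_sup_left
    · change I ^ j * (𝔪 * I ^ (k + 1) ⊔ K * I ^ k) ≤ 𝔪 * I ^ (j + k + 1) ⊔ K * I ^ (j + k)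
      rw [Ideal.mul_sup]
      refine le_of_eq ?_
      congr 1 <;> ring
  suffices h : 𝔪.map (algebraMap R (reesAlgebra I)) ⊔ degOne I K ≤ reesCoeffIdeal I L hL from
    h hf (k + 1)
  refine sup_le ?_ ?_
  · rw [Ideal.map_le_iff_le_comap]
    rintro r hr (_ | k)
    · simpa [L] using hr
    · simp
  · rw [degOne, Ideal.span_le]
    rintro p ⟨x, hx, hpx⟩ k
    rw [hpx, coeff_monomial]
    split_ifs with h
    · subst h
      exact Ideal.mem_sup_right (by simpa using hx)
    · exact Ideal.zero_mem _

lemma mem_sup_of_coe_eq_monomial {I K 𝔪 : Ideal R} (hK : K ≤ I) {k : ℕ} {x : R}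
    (hx : x ∈ 𝔪 * I ^ (k + 1) ⊔ K * I ^ k) {f : reesAlgebra I}
    (hf : (f : R[X]) = monomial (k + 1) x) :
    f ∈ 𝔪.map (algebraMap R (reesAlgebra I)) ⊔ degOne I K := by
  suffices h : ∃ f ∈ 𝔪.map (algebraMap R (reesAlgebra I)) ⊔ degOne I K,
      (f : R[X]) = monomial (k + 1) x by
    obtain ⟨f', hf', hx⟩ := h
    rwa [Subtype.ext (hf.trans hx.symm)]
  clear hf f
  obtain ⟨y, hy, z, hz, rfl⟩ := Submodule.mem_sup.1 hx
  have h1 : ∃ f ∈ 𝔪.map (algebraMap R (reesAlgebra I)), (f : R[X]) = monomial (k + 1) y := by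
    clear hx hz
    induction hy using Submodule.mul_induction_on' with
    | mem_mul_mem r hr b hb =>
      exact ⟨algebraMap _ _ r * ⟨_, reesAlgebra.monomial_mem.2 hb⟩,
        Ideal.mul_mem_right _ _ (Ideal.mem_map_of_mem _ hr), by simp [C_mul_monomial]⟩
    | add a _ b _ ha hb =>
      obtain ⟨p, hp, hpa⟩ := ha
      obtain ⟨q, hq, hqb⟩ := hb
      exact ⟨p + q, Ideal.add_mem _ hp hq, by simp [hpa, hqb]⟩
  have h2 : ∃ f ∈ degOne I K, (f : R[X]) = monomial (k + 1) z := by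
    clear hx hy h1
    induction hz using Submodule.mul_induction_on' with
    | mem_mul_mem r hr b hb =>
      have hrI : monomial 1 r ∈ reesAlgebra I := reesAlgebra.monomial_mem.2 (by simpa using hK hr)
      exact ⟨⟨_, hrI⟩ * ⟨_, reesAlgebra.monomial_mem.2 hb⟩,
        Ideal.mul_mem_right _ _ (Ideal.subset_span ⟨r, hr, rfl⟩), by
          simp [monomial_mul_monomial, add_comm]⟩
    | add a _ b _ ha hb =>
      obtain ⟨p, hp, hpa⟩ := ha
      obtain ⟨q, hq, hqb⟩ := hb
      exact ⟨p + q, Ideal.add_mem _ hp hq, by simp [hpa, hqb]⟩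
  obtain ⟨p, hp, hpy⟩ := h1
  obtain ⟨q, hq, hqz⟩ := h2
  exact ⟨p + q, Submodule.add_mem_sup hp hq, by simp [hpy, hqz]⟩

lemma exists_mem_degOne_pow {I K : Ideal R} (hK : K ≤ I) {M : ℕ} {x : R} (hx : x ∈ K ^ M) :
    ∃ f ∈ degOne I K ^ M, (f : R[X]) = monomial M x := by
  induction M generalizing x with
  | zero => exact ⟨algebraMap _ _ x, by simp, rfl⟩
  | succ M ih =>
    rw [pow_succ] at hx
    induction hx using Submodule.mul_induction_on' with
    | mem_mul_mem r hr b hb =>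
      obtain ⟨f, hf, hfr⟩ := ih hr
      have hb' : monomial 1 b ∈ reesAlgebra I := reesAlgebra.monomial_mem.2 (by simpa using hK hb)
      exact ⟨f * ⟨_, hb'⟩, pow_succ (degOne I K) M ▸ Ideal.mul_mem_mul hf
        (Ideal.subset_span ⟨b, hb, rfl⟩), by simp [hfr, monomial_mul_monomial]⟩
    | add a _ b _ ha hb =>
      obtain ⟨p, hp, hpa⟩ := ha
      obtain ⟨q, hq, hqb⟩ := hb
      exact ⟨p + q, Ideal.add_mem _ hp hq, by simp [hpa, hqb]⟩

/-- If modulo `𝔞` and the maximal ideal the degree one part of `J` vanishes in all the primes of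
the Rees algebra below the irrelevant maximal ideal, then `𝔞` is a reduction. -/
lemma IsReduction.of_degOne_le [IsLocalRing R] [IsNoetherianRing R] {I J 𝔞 : Ideal R}
    (hJ : IsReduction J I) (h𝔞 : 𝔞 ≤ I)
    (h : ∀ P : Ideal (reesAlgebra I), P.IsPrime → P ≤ reesMaximal I →
      (maximalIdeal R).map (algebraMap R (reesAlgebra I)) ⊔ degOne I 𝔞 ≤ P → degOne I J ≤ P) :
    IsReduction 𝔞 I := by
  set Q := (maximalIdeal R).map (algebraMap R (reesAlgebra I)) ⊔ degOne I 𝔞 with hQ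
  have hrad : degOne I J ≤ Q.radical := by
    rw [degOne, Ideal.span_le]
    rintro p ⟨x, hx, hpx⟩
    have hnd : ¬ Disjoint (Q : Set (reesAlgebra I))
        ((reesMaximal I).primeCompl ⊔ Submonoid.powers p : Submonoid (reesAlgebra I)) := by
      intro hd
      obtain ⟨P, hP, hQP, hdP⟩ := Ideal.exists_le_prime_disjoint Q _ hd
      refine Set.disjoint_left.1 hdP (h P hP (fun f hf => ?_) hQP (Ideal.subset_span ⟨x, hx, hpx⟩))
        (le_sup_right (a := (reesMaximal I).primeCompl) (Submonoid.mem_powers p))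
      by_contra hfM
      exact Set.disjoint_left.1 hdP hf
        (le_sup_left (b := Submonoid.powers p) (show f ∈ (reesMaximal I).primeCompl from hfM))
    obtain ⟨f, hf, hfS⟩ := Set.not_disjoint_iff.1 hnd
    obtain ⟨v, hv, _, ⟨N, rfl⟩, rfl⟩ := Submonoid.mem_sup.1 hfS
    refine ⟨N + 1, mem_sup_of_coe_eq_monomial (k := N) (x := x ^ (N + 1)) h𝔞 ?_ ?_⟩
    · have hv0 : IsUnit ((v : R[X]).coeff 0) := by
        by_contra hvn
        exact hv (mem_reesMaximal.2 ((mem_maximalIdeal _).2 hvn))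
      have := coeff_mem_of_mem_sup (k := N) (f := v * p ^ (N + 1))
        (by rw [pow_succ, ← mul_assoc]; exact Ideal.mul_mem_right _ _ hf)
      rw [MulMemClass.coe_mul, SubmonoidClass.coe_pow, hpx, monomial_pow, one_mul] at this
      have hcoeff := coeff_mul_monomial (v : R[X]) (N + 1) 0 (x ^ (N + 1))
      rw [zero_add] at hcoeff
      rw [hcoeff] at this
      exact (Ideal.unit_mul_mem_iff_mem _ hv0).1 this
    · rw [SubmonoidClass.coe_pow, hpx, monomial_pow, one_mul]
  obtain ⟨M, hM⟩ := Ideal.exists_pow_le_of_le_radical_of_fg hrad (IsNoetherian.noetherian _)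
  have hJM : J ^ (M + 1) ≤ maximalIdeal R * I ^ (M + 1) ⊔ 𝔞 * I ^ M := by
    intro x hx
    obtain ⟨f, hf, hfx⟩ := exists_mem_degOne_pow hJ.1 hx
    have := coeff_mem_of_mem_sup (hM (Ideal.pow_le_pow_right (Nat.le_succ M) hf)) M
    rwa [hfx, coeff_monomial_same] at this
  obtain ⟨N, hN⟩ := hJ.2
  have hpow : ∀ k, I ^ (N + k) = J ^ k * I ^ N := by
    intro k
    induction k with
    | zero => simp
    | succ k ih => rw [← add_assoc, pow_succ, ih, mul_assoc, ← pow_succ, hN, pow_succ, mul_assoc]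
  refine ⟨h𝔞, N + M, le_antisymm ?_ ?_⟩
  · refine Submodule.le_of_le_smul_of_le_jacobson_bot (I := maximalIdeal R)
      (IsNoetherian.noetherian _) (IsLocalRing.maximalIdeal_le_jacobson _) ?_
    calc I ^ (N + M + 1) = J ^ (M + 1) * I ^ N := by rw [← hpow, add_assoc]
      _ ≤ (maximalIdeal R * I ^ (M + 1) ⊔ 𝔞 * I ^ M) * I ^ N := Ideal.mul_mono_left hJM
      _ = 𝔞 * I ^ (N + M) ⊔ maximalIdeal R • I ^ (N + M + 1) := by
        rw [Ideal.sup_mul, sup_comm, smul_eq_mul]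
        congr 1 <;> ring
  · rw [pow_succ']
    exact Ideal.mul_mono_left h𝔞

variable [IsLocalRing R] [IsNoetherianRing R] [Infinite (ResidueField R)]

/-- A minimal reduction is generated by any sufficiently general sequence of length the analytic
spread. -/
lemma IsMinimalReduction.exists_isGeneralSeq {I J : Ideal R} (hJ : IsMinimalReduction J I) {ℓ : ℕ}
    (hl : analyticSpread R I = ((ℓ : ℕ∞) : WithBot ℕ∞)) :
    ∃ a, IsGeneralSeq I J ℓ a ∧ spanLT a ℓ = J := by
  set 𝔪A := (maximalIdeal R).map (algebraMap R (reesAlgebra I)) with h𝔪A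
  obtain ⟨a, ha, hE⟩ := _root_.exists_isGeneralSeq I J ℓ
    (fun K => degOneComap '' (𝔪A ⊔ degOne I K).minimalPrimes)
    (fun K => (Ideal.finite_minimalPrimes_of_isNoetherianRing _ _).image _)
  refine ⟨a, ha, hJ.2 _ (ha.spanLT_le_left ℓ)
    (hJ.1.of_degOne_le ((ha.spanLT_le_left ℓ).trans hJ.1.1) ?_)⟩
  let Z := PrimeSpectrum.zeroLocus (𝔪A : Set (reesAlgebra I))
  have hdim : Order.krullDim Z = ((ℓ : ℕ∞) : WithBot ℕ∞) := by
    rw [← hl, analyticSpread, ringKrullDim_quotient]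
  have hheight : ∀ i (P : Z), degOne I (spanLT a i) ≤ P.1.asIdeal → ¬ degOne I J ≤ P.1.asIdeal →
      (i : ℕ∞) ≤ Order.height P := by
    intro i
    induction i with
    | zero => simp
    | succ i ih =>
      intro P hP hJP
      obtain ⟨P', hP', hle⟩ := Ideal.exists_minimalPrimes_le (I := 𝔪A ⊔ degOne I (spanLT a i))
        (J := P.1.asIdeal) (sup_le P.2 ((degOne_mono (spanLT_mono a (Nat.le_succ i))).trans hP))
      have hJP' : ¬ degOne I J ≤ P' := fun h => hJP (h.trans hle)
      have hai := hE i _ ⟨P', hP', rfl⟩ (mt (degOne_le_iff hJ.1.1).2 hJP')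
      let P'' : Z := ⟨⟨P', hP'.1.1⟩, le_sup_left.trans hP'.1.2⟩
      have hlt : P'' < P := by
        refine lt_of_le_of_ne hle ?_
        rintro rfl
        exact hai ((degOne_le_iff ((ha.spanLT_le_left _).trans hJ.1.1)).1 hP
          (mem_spanLT a (Nat.lt_succ_self i)))
      push_cast
      exact (add_le_add_left (ih P'' (le_sup_right.trans hP'.1.2) hJP') 1).trans
        (Order.height_add_one_le hlt)
  intro P hP hPM hle
  by_contra hJP
  have h1 := hheight ℓ ⟨⟨P, hP⟩, le_sup_left.trans hle⟩ (le_sup_right.trans hle) hJP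
  let M : Z := ⟨⟨reesMaximal I, inferInstance⟩, map_le_reesMaximal I⟩
  have hlt : (⟨⟨P, hP⟩, le_sup_left.trans hle⟩ : Z) < M := by
    refine lt_of_le_of_ne hPM fun h => hJP ?_
    have : P = reesMaximal I := congrArg (fun z : Z => z.1.asIdeal) h
    exact this ▸ degOne_le_reesMaximal I J
  have h2 := (add_le_add_left h1 1).trans (Order.height_add_one_le hlt)
  have h3 := Order.height_le_krullDim M
  rw [hdim, WithBot.coe_le_coe] at h3
  have h4 := h2.trans h3
  norm_cast at h4
  omega

end ReesAlgebra

/-! ### Subquotients of the ring -/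

section SubQuotient

variable {R : Type u} [CommRing R]

/-- The subquotient `X / (X ∩ Y)` of the ring. -/
abbrev SubQuot (X Y : Ideal R) : Type u := X ⧸ Submodule.submoduleOf Y X

variable {X Y X' Y' Y'' : Ideal R}

/-- Multiplication by an element, as a map between subquotients of the ring. -/
def SubQuot.mulMap (r : R) (hX : ∀ x ∈ X, r * x ∈ X') (hY : ∀ x ∈ X, x ∈ Y → r * x ∈ Y') :
    SubQuot X Y →ₗ[R] SubQuot X' Y' :=
  Submodule.mapQ _ _ ((LinearMap.lsmul R R r).restrict hX) fun x hx => hY x x.2 hx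

namespace SubQuot

lemma mk_eq_zero {x : X} :
    (Submodule.Quotient.mk x : SubQuot X Y) = 0 ↔ (x : R) ∈ Y := by
  rw [Submodule.Quotient.mk_eq_zero]
  rfl

lemma mulMap_mk {r : R} (hX : ∀ x ∈ X, r * x ∈ X') (hY : ∀ x ∈ X, x ∈ Y → r * x ∈ Y') (x : X) :
    mulMap r hX hY (Submodule.Quotient.mk x) = Submodule.Quotient.mk ⟨r * x, hX x x.2⟩ := rfl

lemma mulMap_injective {r : R} (hX : ∀ x ∈ X, r * x ∈ X') (hY : ∀ x ∈ X, x ∈ Y → r * x ∈ Y')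
    (h : ∀ x ∈ X, r * x ∈ Y' → x ∈ Y) : Function.Injective (mulMap r hX hY) := by
  rw [injective_iff_map_eq_zero]
  intro z hz
  obtain ⟨x, rfl⟩ := Submodule.Quotient.mk_surjective _ z
  rw [mulMap_mk, mk_eq_zero] at hz
  exact mk_eq_zero.2 (h x x.2 hz)

lemma smul_ker_eq_zero {r s : R} (hX : ∀ x ∈ X, r * x ∈ X') (hY : ∀ x ∈ X, x ∈ Y → r * x ∈ Y')
    (h : ∀ x ∈ X, r * x ∈ Y' → s * x ∈ Y) (z : LinearMap.ker (mulMap r hX hY)) : s • z = 0 := by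
  obtain ⟨z, hz⟩ := z
  obtain ⟨x, rfl⟩ := Submodule.Quotient.mk_surjective _ z
  rw [LinearMap.mem_ker, mulMap_mk, mk_eq_zero] at hz
  refine Subtype.ext ?_
  change s • (Submodule.Quotient.mk x : SubQuot X Y) = 0
  rw [← Submodule.Quotient.mk_smul]
  exact mk_eq_zero.2 (h x x.2 hz)

/-- The projection between subquotients with the same numerator. -/
def proj (h : Y' ≤ Y'') : SubQuot X' Y' →ₗ[R] SubQuot X' Y'' :=
  mulMap 1 (fun x hx => by simpa using hx) (fun x _ hx => by simpa using h hx)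

lemma proj_surjective (h : Y' ≤ Y'') : Function.Surjective (proj (X' := X') h) := by
  intro z
  obtain ⟨x, rfl⟩ := Submodule.Quotient.mk_surjective _ z
  refine ⟨Submodule.Quotient.mk x, ?_⟩
  rw [proj, mulMap_mk]
  simp

lemma exact_mulMap_proj {r : R} (hX : ∀ x ∈ X, r * x ∈ X') (hY : ∀ x ∈ X, x ∈ Y → r * x ∈ Y')
    (h : Y' ≤ Y'') (h1 : ∀ x ∈ X, r * x ∈ Y'')
    (h2 : ∀ x ∈ X', x ∈ Y'' → ∃ z ∈ X, x - r * z ∈ Y') :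
    Function.Exact (mulMap r hX hY) (proj (X' := X') h) := by
  intro z
  obtain ⟨x, rfl⟩ := Submodule.Quotient.mk_surjective _ z
  rw [proj, mulMap_mk, mk_eq_zero]
  constructor
  · intro hx
    obtain ⟨z, hz, hxz⟩ := h2 x x.2 (by simpa using hx)
    refine ⟨Submodule.Quotient.mk ⟨z, hz⟩, ?_⟩
    rw [mulMap_mk, eq_comm, ← sub_eq_zero, ← Submodule.Quotient.mk_sub, mk_eq_zero]
    exact hxz
  · rintro ⟨w, hw⟩
    obtain ⟨z, rfl⟩ := Submodule.Quotient.mk_surjective _ w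
    rw [mulMap_mk, ← sub_eq_zero, ← Submodule.Quotient.mk_sub, mk_eq_zero] at hw
    have := Y''.sub_mem (h1 z z.2) (h hw)
    simpa using this

/-- The quotient ring as a subquotient. -/
def topEquiv (K : Ideal R) : (R ⧸ K) ≃ₗ[R] SubQuot ⊤ K :=
  Submodule.Quotient.equiv _ _ Submodule.topEquiv.symm (by
    ext x
    rw [Submodule.mem_map]
    constructor
    · rintro ⟨y, hy, rfl⟩
      exact hy
    · intro hx
      exact ⟨x, hx, rfl⟩)

end SubQuot

open SubQuot

variable {p : Ideal R} {I : Ideal R} {a : ℕ → R}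

lemma exact_mulMap_spanLT (haI : ∀ i, a i ∈ I) (i j : ℕ) :
    ∃ f : SubQuot (I ^ j) (spanLT a i * I ^ (j - 1)) →ₗ[R]
        SubQuot (I ^ (j + 1)) (spanLT a i * I ^ j),
      ∃ g : SubQuot (I ^ (j + 1)) (spanLT a i * I ^ j) →ₗ[R]
        SubQuot (I ^ (j + 1)) (spanLT a (i + 1) * I ^ j),
      Function.Exact f g ∧ Function.Surjective g ∧
        ∀ s : R, (∀ x ∈ I ^ j, a i * x ∈ spanLT a i * I ^ j → s * x ∈ spanLT a i * I ^ (j - 1)) →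
          ∀ z : LinearMap.ker f, s • z = 0 := by
  have hX : ∀ x ∈ I ^ j, a i * x ∈ I ^ (j + 1) := fun x hx =>
    pow_succ' I j ▸ Ideal.mul_mem_mul (haI i) hx
  have hY : ∀ x ∈ I ^ j, x ∈ spanLT a i * I ^ (j - 1) → a i * x ∈ spanLT a i * I ^ j := by
    intro x _ hx
    have h1 := Ideal.mul_mem_mul (haI i) hx
    rw [mul_left_comm, ← pow_succ'] at h1
    exact Ideal.mul_mono_right (Ideal.pow_le_pow_right (by omega)) h1
  have hle : spanLT a i * I ^ j ≤ spanLT a (i + 1) * I ^ j :=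
    Ideal.mul_mono_left (spanLT_mono a (Nat.le_succ i))
  refine ⟨mulMap (a i) hX hY, proj hle, exact_mulMap_proj hX hY hle (fun x hx =>
    Ideal.mul_mem_mul (mem_spanLT a (Nat.lt_succ_self i)) hx) (fun x _ hx => ?_),
    proj_surjective hle, fun s hs => smul_ker_eq_zero hX hY hs⟩
  rw [spanLT_succ, Ideal.sup_mul] at hx
  obtain ⟨α, hα, β, hβ, rfl⟩ := Submodule.mem_sup.1 hx
  obtain ⟨z, hz, rfl⟩ := Ideal.mem_span_singleton_mul.1 hβ
  exact ⟨z, hz, by simpa using hα⟩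

lemma extLocZero_subQuot [hp : p.IsPrime] {g m : ℕ} (hreg : IsRegularSeq a g)
    (haI : ∀ i, a i ∈ I) {y : ℕ → R} (hy : IsRegularSeq y (g + m + 1))
    (hker : ∀ k < g + m + 1, ∀ i < g + m + 1, ∀ j, ∃ e, ∀ x ∈ I ^ (j + 1),
      a i * x ∈ spanLT a i * I ^ (j + 1) → y k ^ e * x ∈ spanLT a i * I ^ j)
    (hExt : ∀ j, 1 ≤ j → j ≤ m + 1 → ExtLocZero p R (R ⧸ I ^ j) (g + j))
    {i j : ℕ} (hij : i + 2 ≤ j + g) (hj : j ≤ m + 1) :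
    ExtLocZero p R (SubQuot (I ^ j) (spanLT a i * I ^ (j - 1))) (g + j - 1) := by
  induction j generalizing i with
  | zero =>
    have h := ((extLoc_quot_spanLT (p := p) hreg (i := i) (by omega)).2 (g - 1)
      (by omega)).of_equiv (topEquiv _)
    have h0 : spanLT a i * I ^ (0 - 1) = spanLT a i := by simp
    rw [h0, pow_zero, Ideal.one_eq_top]
    exact h
  | succ j ihj =>
    induction i with
    | zero =>
      have hB := (ExtLocZero.ring (N := R) (k := g + j) hp.ne_top (by omega)).of_equiv
        ((ExtMod.quotSpanLTZero a).trans (topEquiv (spanLT a 0)))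
      have hC := (hExt (j + 1) (by omega) hj).of_equiv (topEquiv (I ^ (j + 1)))
      have hX : ∀ x ∈ I ^ (j + 1), (1 : R) * x ∈ (⊤ : Ideal R) := fun x _ => trivial
      have hY : ∀ x ∈ I ^ (j + 1), x ∈ spanLT a 0 * I ^ (j + 1 - 1) → 1 * x ∈ spanLT a 0 :=
        fun x _ hx => by simpa using Ideal.mul_le_left hx
      have h0 : spanLT a 0 ≤ I ^ (j + 1) := by simp [spanLT_zero]
      refine ExtLocZero.left (f := mulMap 1 hX hY) (g := proj h0)
        (mulMap_injective hX hY fun x _ hx => ?_)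
        (exact_mulMap_proj hX hY h0 (fun x hx => by simpa using hx)
          fun x _ hx => ⟨x, hx, by simp⟩) (proj_surjective h0) hB hC
      simpa [spanLT_zero] using hx
    | succ i ihi =>
      obtain ⟨f, q, hex, hsurj, hf⟩ := exact_mulMap_spanLT haI i j
      obtain ⟨k, hk⟩ : ∃ k, g + j = k + 1 := ⟨g + j - 1, by omega⟩
      have hA := ihj (i := i) (by omega) (by omega)
      have hB := ihi (by omega)
      rw [show g + j - 1 = k by omega] at hA
      rw [show g + (j + 1) - 1 = k + 1 by omega] at hB ⊢
      refine ExtLocZero.fourTerm hex hsurj (fun l hl e => ExtMod.eq_zero_of_regular' hy ?_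
        (by omega : l < g + m + 1) e) hA hB
      intro t ht
      cases j with
      | zero =>
        refine ⟨0, hf _ fun x _ hx => ?_⟩
        have := hreg i (by omega) x (by simpa using hx)
        simpa using this
      | succ j =>
        obtain ⟨e, he⟩ := hker t ht i (by omega) j
        exact ⟨e, hf _ he⟩

lemma extLocCyclic_subQuot [hp : p.IsPrime] {g m : ℕ} (hreg : IsRegularSeq a g)
    (haI : ∀ i, a i ∈ I) {y : ℕ → R} (hy : IsRegularSeq y (g + m + 1))
    (hker : ∀ k < g + m + 1, ∀ i < g + m + 1, ∀ j, ∃ e, ∀ x ∈ I ^ (j + 1),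
      a i * x ∈ spanLT a i * I ^ (j + 1) → y k ^ e * x ∈ spanLT a i * I ^ j)
    (hExt : ∀ j, 1 ≤ j → j ≤ m + 1 → ExtLocZero p R (R ⧸ I ^ j) (g + j))
    {j : ℕ} (hj : j ≤ m) :
    ExtLocCyclic p R (SubQuot (I ^ (j + 1)) (spanLT a (g + j) * I ^ j)) (g + j) := by
  induction j with
  | zero =>
    have hB := (extLoc_quot_spanLT (p := p) hreg le_rfl).1.of_equiv (topEquiv (spanLT a g))
    have hC := (hExt 1 le_rfl (by omega)).of_equiv (topEquiv _)
    have hX : ∀ x ∈ I ^ (0 + 1), (1 : R) * x ∈ (⊤ : Ideal R) := fun x _ => trivial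
    have hY : ∀ x ∈ I ^ (0 + 1), x ∈ spanLT a (g + 0) * I ^ 0 → 1 * x ∈ spanLT a g :=
      fun x _ hx => by simpa using hx
    have h0 : spanLT a g ≤ I ^ 1 := by simpa using spanLT_le haI g
    exact ExtLocCyclic.left (f := mulMap 1 hX hY) (g := proj h0)
      (mulMap_injective hX hY fun x _ hx => by simpa using hx)
      (exact_mulMap_proj hX hY h0 (fun x hx => by simpa using hx)
        fun x _ hx => ⟨x, hx, by simp⟩) (proj_surjective h0) hB hC
  | succ j ih =>
    obtain ⟨f, q, hex, hsurj, hf⟩ := exact_mulMap_spanLT haI (g + j) (j + 1)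
    have hB := extLocZero_subQuot hreg haI hy hker hExt (i := g + j) (j := j + 2) (by omega)
      (by omega)
    refine ExtLocCyclic.fourTerm hex hsurj (fun l hl e => ExtMod.eq_zero_of_regular' hy ?_
      (hl.trans_lt (by omega : g + j < g + m + 1)) e) (ih (by omega)) hB
    intro t ht
    obtain ⟨e, he⟩ := hker t ht (g + j) (by omega) j
    exact ⟨e, hf _ he⟩

/-- Multiplication by `b` on `I^k / (I^k ∩ K)` divides multiplication by the elements of `I` when
`I^(k+1) ⊆ b I^k + K` and `b` is regular modulo `K`. -/
lemma SubQuot.exists_smul_eq_smul {K : Ideal R} {k : ℕ} {b x : R} (hb : b ∈ I) (hx : x ∈ I)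
    (hreg : ∀ z, b * z ∈ K → z ∈ K) (hpow : ∀ z ∈ I ^ (k + 1), ∃ w ∈ I ^ k, z - b * w ∈ K) :
    ∃ φ : SubQuot (I ^ k) K →ₗ[R] SubQuot (I ^ k) K, ∀ z, b • φ z = x • z := by
  have hX : ∀ x ∈ I, ∀ z ∈ I ^ k, x * z ∈ I ^ (k + 1) := fun x hx z hz =>
    pow_succ' I k ▸ Ideal.mul_mem_mul hx hz
  have hY : ∀ x, ∀ z ∈ I ^ k, z ∈ K → x * z ∈ K := fun x z _ hz => K.mul_mem_left _ hz
  let α := mulMap b (hX b hb) (hY b)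
  let ξ := mulMap x (hX x hx) (hY x)
  have hα : Function.Bijective α := by
    refine ⟨mulMap_injective _ _ fun z _ => hreg z, fun z => ?_⟩
    obtain ⟨z, rfl⟩ := Submodule.Quotient.mk_surjective _ z
    obtain ⟨w, hw, hzw⟩ := hpow z z.2
    refine ⟨Submodule.Quotient.mk ⟨w, hw⟩, ?_⟩
    rw [mulMap_mk, eq_comm, ← sub_eq_zero, ← Submodule.Quotient.mk_sub, mk_eq_zero]
    exact hzw
  let ι : SubQuot (I ^ (k + 1)) K →ₗ[R] SubQuot (I ^ k) K := mulMap 1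
    (fun z hz => (one_mul z).symm ▸ Ideal.pow_le_pow_right (Nat.le_succ k) hz)
    (fun z _ hz => (one_mul z).symm ▸ hz)
  have hι : ∀ y (hy : y ∈ I) z, ι (mulMap y (hX y hy) (hY y) z) = y • z := by
    intro y hy z
    obtain ⟨z, rfl⟩ := Submodule.Quotient.mk_surjective _ z
    change ι (Submodule.Quotient.mk _) = _
    rw [mulMap_mk, ← Submodule.Quotient.mk_smul]
    congr 1
    exact Subtype.ext (one_mul _)
  let E := LinearEquiv.ofBijective α hα
  refine ⟨E.symm.toLinearMap ∘ₗ ξ, fun z => ?_⟩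
  rw [← hι b hb, ← hι x hx]
  exact congrArg ι (E.apply_symm_apply (ξ z))

end SubQuotient

section Main

variable {R : Type u} [CommRing R] [IsNoetherianRing R] [IsLocalRing R] [Infinite (ResidueField R)]

open SubQuot

/-- An ideal of height at least `i` that is locally generated by `i` elements is locally generated
by a regular sequence of length `i`. -/
lemma exists_isRegularSeq_mul_mem (hCM : IsCohenMacaulayLocalRing R) {K q : Ideal R} {i : ℕ}
    (hK : ∀ Q : Ideal R, Q.IsPrime → K ≤ Q → i ≤ natHeight Q) (hq : q.IsPrime)
    (h : LocGen ⊥ K q i) :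
    ∃ y : ℕ → R, (∀ k, y k ∈ K) ∧ IsRegularSeq y i ∧ ∃ w ∉ q, ∀ x ∈ K, w * x ∈ spanLT y i := by
  obtain ⟨y, hy⟩ := exists_general_sequence K
    (fun L => {P | IsAssocTo L P} ∪ {satIdeal (L ⊔ q * K) q})
    (fun L => (finite_setOf_isAssocTo L).union (Set.finite_singleton _))
  refine ⟨y, fun k => (hy k).1, isRegularSeq_of_forall_notMem hCM hK
    fun k e he => (hy k).2 e (Or.inl he), ?_⟩
  have hgen : ∀ k ≤ i, LocGen (spanLT y k) K q (i - k) := by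
    intro k hk
    induction k with
    | zero => exact h.mono bot_le le_rfl
    | succ k ih =>
      by_cases hle : K ≤ satIdeal (spanLT y k ⊔ q * K) q
      · exact (LocGen.of_exists (exists_mul_mem_of_mul_mem_sup hq
          (exists_uniform hq fun x hx => (mem_satIdeal hq).1 (hle hx))) _).mono
          (spanLT_mono y (Nat.le_succ k)) le_rfl
      · rw [spanLT_succ]
        refine LocGen.sup_span hq ?_ (hy k).1 ((hy k).2 _ (Or.inr rfl) hle)
        rw [show i - (k + 1) + 1 = i - k by omega]
        exact ih (by omega)
  have := hgen i le_rfl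
  rw [Nat.sub_self] at this
  exact this.exists_mul_mem

variable {I J : Ideal R} {ℓ g : ℕ} {a : ℕ → R}

namespace IsGeneralSeq

lemma exists_pow_mul_mem (hCM : IsCohenMacaulayLocalRing R) (ha : IsGeneralSeq I J ℓ a)
    (hJ : IsReduction J I) (hJI : J ≠ I) (hG : IdealGs I ℓ) (hg : idealGrade I = g)
    (hS2 : WeaklyResiduallyS2Lt I g ℓ) (hspan : spanLT a ℓ = J) {u : R}
    (hu : u ∈ Submodule.colon J (I : Set R)) {i : ℕ} (hi : i ≤ ℓ) (m : ℕ) :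
    ∃ e, ∀ x ∈ I ^ (m + 1), x ∈ Submodule.colon (spanLT a i) (I : Set R) →
      u ^ e * x ∈ spanLT a i * I ^ m := by
  have hc := fun q hq h => hJ.le_natHeight_of_colon_le hCM hJI hG hg hS2 (q := q) hq h
  induction m generalizing i with
  | zero =>
    obtain rfl | hlt := hi.eq_or_lt
    · refine ⟨1, fun x hx _ => ?_⟩
      simpa [hspan] using mem_colon_ideal.1 hu x (by simpa using hx)
    · refine ⟨0, fun x hx hxK => ?_⟩
      simpa using (ha.residual hCM hJ hJI hG hg hS2 le_rfl hc hi).1 hlt x (by simpa using hx) hxK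
  | succ m ihm =>
    obtain ⟨d, hd⟩ := Nat.exists_eq_add_of_le hi
    induction d generalizing i with
    | zero =>
      obtain rfl : i = ℓ := by omega
      refine ⟨1, fun x hx hxK => ?_⟩
      clear hxK
      rw [pow_succ'] at hx
      rw [pow_one]
      induction hx using Submodule.mul_induction_on' with
      | mem_mul_mem b hb z hz =>
        rw [← mul_assoc]
        refine Ideal.mul_mem_mul ?_ hz
        have := mem_colon_ideal.1 hu b hb
        rwa [← hspan] at this
      | add b _ z _ hb hz =>
        rw [mul_add]
        exact Ideal.add_mem _ hb hz
    | succ d ihd =>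
      obtain ⟨e₁, h₁⟩ := ihm hi
      obtain ⟨e₂, h₂⟩ := ihd (i := i + 1) (by omega) (by omega)
      refine ⟨e₁ + e₂, fun x hx hxK => ?_⟩
      have hxK' : x ∈ Submodule.colon (spanLT a (i + 1)) (I : Set R) := mem_colon_ideal.2
        fun b hb => spanLT_mono a (Nat.le_succ i) (mem_colon_ideal.1 hxK b hb)
      have hx2 := h₂ x hx hxK'
      rw [spanLT_succ, Ideal.sup_mul] at hx2
      obtain ⟨α, hα, β, hβ, hαβ⟩ := Submodule.mem_sup.1 hx2
      obtain ⟨z, hz, rfl⟩ := Ideal.mem_span_singleton_mul.1 hβ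
      have hzK : z ∈ Submodule.colon (spanLT a i) (I : Set R) := by
        refine ha.regular_colon hJ hG le_rfl hc (by omega)
          (ha.residual hCM hJ hJI hG hg hS2 le_rfl hc hi).2 ?_
        have h3 : a i * z = u ^ e₂ * x - α := by rw [← hαβ]; ring
        rw [h3]
        exact Ideal.sub_mem _ (Ideal.mul_mem_left _ _ hxK)
          (mem_colon_ideal.2 fun b _ => Ideal.mul_mem_right _ _ (Ideal.mul_le_left hα))
      have h4 := Ideal.mul_mem_mul (hJ.1 (ha.mem i)) (h₁ z hz hzK)
      rw [mul_left_comm I, ← pow_succ'] at h4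
      have h5 : u ^ (e₁ + e₂) * x = u ^ e₁ * α + a i * (u ^ e₁ * z) := by
        rw [pow_add, mul_assoc, ← hαβ]
        ring
      rw [h5]
      exact Ideal.add_mem _ (Ideal.mul_mem_left _ _ hα) h4

/-- The colon ideal of all but the last element of a general sequence is locally generated by a
regular sequence at its associated primes. -/
lemma locGen_colon (hCM : IsCohenMacaulayLocalRing R) (ha : IsGeneralSeq I J ℓ a)
    (hJ : IsReduction J I) (hJI : J ≠ I) (hG : IdealGs I ℓ) (hg : idealGrade I = g)
    (hS2 : WeaklyResiduallyS2Lt I g ℓ) {i : ℕ} (hi : i < ℓ) {q : Ideal R}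
    (hq : IsAssocTo (Submodule.colon (spanLT a i) (I : Set R)) q) :
    LocGen ⊥ (Submodule.colon (spanLT a i) (I : Set R)) q i := by
  classical
  have hc := fun q hq h => hJ.le_natHeight_of_colon_le hCM hJI hG hg hS2 (q := q) hq h
  have hqi := (ha.residual hCM hJ hJI hG hg hS2 le_rfl hc hi.le).2 q hq
  obtain ⟨b, hb, hbq⟩ := SetLike.not_le_iff_exists.1 fun hI : I ≤ q =>
    absurd (ha.lt_natHeight hJ hG le_rfl hc hi hq.isPrime hI hq.le) hqi.not_gt
  refine ⟨(Finset.range i).image a, Finset.card_image_le.trans (by simp), fun x hx => ?_, b, hbq,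
    fun x hx => Ideal.mem_sup_right ?_⟩
  · obtain ⟨j, hj, rfl⟩ := Finset.mem_image.1 hx
    exact mem_colon_ideal.2 fun b _ =>
      Ideal.mul_mem_right _ _ (mem_spanLT a (Finset.mem_range.1 hj))
  · have := mem_colon_ideal.1 hx b hb
    rw [mul_comm, spanLT] at this
    simpa [Set.Iio_def] using this

end IsGeneralSeq

/-- The reduction number of an ideal with the given properties is large. -/
lemma pow_ne_of_extLocZero (hCM : IsCohenMacaulayLocalRing R) {m : ℕ}
    (ha : IsGeneralSeq I J (g + m + 1) a) (hJ : IsReduction J I) (hJI : J ≠ I)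
    (hG : IdealGs I (g + m + 1)) (hg : idealGrade I = g)
    (hS2 : WeaklyResiduallyS2Lt I g (g + m + 1)) (hspan : spanLT a (g + m + 1) = J)
    (hExt : ∀ p : Ideal R, p.IsPrime → I ≤ p → natHeight p ≤ g + m + 1 →
      ∀ j, 1 ≤ j → j ≤ m + 1 → ExtLocZero p R (R ⧸ I ^ j) (g + j)) :
    I ^ (m + 2) ≠ J * I ^ (m + 1) := by
  intro hpow
  have hc := fun q hq h => hJ.le_natHeight_of_colon_le hCM hJI hG hg hS2 (q := q) hq h
  have hres := fun {i} hi => ha.residual hCM hJ hJI hG hg hS2 le_rfl hc (i := i) hi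
  set c := Submodule.colon J (I : Set R) with hcdef
  have hctop : c ≠ ⊤ := fun htop => hJI <| le_antisymm hJ.1 fun x hx => by
    simpa using mem_colon_ideal.1 (htop ▸ trivial : (1 : R) ∈ c) x hx
  obtain ⟨M, hM, hcM⟩ := Ideal.exists_le_maximal c hctop
  have := hM.isPrime
  obtain ⟨p, hpc, -⟩ := Ideal.exists_minimalPrimes_le hcM
  have hp : p.IsPrime := hpc.1.1
  have hcp : c ≤ p := hpc.1.2
  have hJc : J ≤ c := fun x hx => mem_colon_ideal.2 fun b _ => Ideal.mul_mem_right _ _ hx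
  have hIp : I ≤ p := hJ.le_of_le hp (hJc.trans hcp)
  have hpA : IsAssocTo c p := isAssocTo_of_minimal hp hcp fun P hP hcP hPp =>
    le_antisymm hPp (hpc.2 ⟨hP, hcP⟩ hPp)
  have hpl : natHeight p ≤ g + m + 1 := (hres le_rfl).2 p (by rwa [hspan])
  obtain ⟨y, hyc, hy⟩ := exists_isRegularSeq hCM hc
  have hhun {i} (hi : i ≤ g + m + 1) (u) (hu : u ∈ c) :=
    ha.exists_pow_mul_mem hCM hJ hJI hG hg hS2 hspan hu hi
  have hle𝔞 (i) : spanLT a i ≤ Submodule.colon (spanLT a i) (I : Set R) := fun x hx =>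
    mem_colon_ideal.2 fun b _ => Ideal.mul_mem_right _ _ hx
  have hregK {i} (hi : i < g + m + 1) {x : R} :=
    ha.regular_colon hJ hG le_rfl hc hi (hres hi.le).2 (x := x)
  have hcyc := extLocCyclic_subQuot (ha.isRegularSeq hCM hJ hg) (fun i => hJ.1 (ha.mem i)) hy
    (fun k _ i hi j => (hhun hi.le _ (hyc k) j).imp fun e he x hx hax =>
      he x hx (hregK hi (hle𝔞 i (Ideal.mul_le_left hax)))) (hExt p hp hIp hpl) (j := m) le_rfl
  set K := Submodule.colon (spanLT a (g + m)) (I : Set R) with hK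
  set b := a (g + m) with hbdef
  have hbI : b ∈ I := hJ.1 (ha.mem _)
  have hbreg : ∀ x, b * x ∈ K → x ∈ K := fun x => hregK (by omega)
  have hprojle : spanLT a (g + m) * I ^ m ≤ K := Ideal.mul_le_left.trans (hle𝔞 _)
  replace hcyc : ExtLocCyclic p R (SubQuot (I ^ (m + 1)) K) (g + m) := by
    refine hcyc.of_surjective (proj_surjective hprojle) fun l hl e =>
      ExtMod.eq_zero_of_regular' hy (fun k hk => ?_) (hl.trans_lt (by omega)) e
    obtain ⟨e, he⟩ := hhun (i := g + m) (by omega) _ (hyc k) m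
    exact ⟨e, smul_ker_eq_zero _ _ fun x hx hxK => he x hx (by simpa using hxK)⟩
  have hdiv : ∀ z ∈ I ^ (m + 1 + 1), ∃ w ∈ I ^ (m + 1), z - b * w ∈ K := by
    intro z hz
    have hz : z ∈ J * I ^ (m + 1) := hpow ▸ hz
    rw [← hspan, spanLT_succ, Ideal.sup_mul] at hz
    obtain ⟨α, hα, β, hβ, rfl⟩ := Submodule.mem_sup.1 hz
    obtain ⟨w, hw, rfl⟩ := Ideal.mem_span_singleton_mul.1 hβ
    exact ⟨w, hw, by
      rw [← hbdef, add_sub_cancel_right]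
      exact hle𝔞 _ (Ideal.mul_le_left hα)⟩
  have hloc : ∀ x ∈ I, ∃ u ∉ p, u * x ∈ J := by
    intro x hx
    obtain ⟨φ, hφ⟩ := SubQuot.exists_smul_eq_smul hbI hx hbreg hdiv
    obtain ⟨s, hs, r, hsr⟩ := hcyc.exists_smul_eq_zero φ hφ
    obtain ⟨v, hv, hvK⟩ : ∃ v ∉ p, v * (s * x - b * r) ∈ K := by
      refine exists_mul_mem_of_isAssocTo hp fun q hq hqp => ?_
      have hKht : ∀ Q : Ideal R, Q.IsPrime → K ≤ Q → g + m ≤ natHeight Q := by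
        have := (ha.isGeometricResidualIntersection hJ hJI hG le_rfl hc
          (i := g + m) (by omega)).1.2.2.2
        rwa [natCast_le_idealHeight] at this
      obtain ⟨y', hy'K, hy', w, hw, hwK⟩ := exists_isRegularSeq_mul_mem hCM hKht hq.isPrime
        (ha.locGen_colon hCM hJ hJI hG hg hS2 (by omega) hq)
      let ψ : SubQuot (I ^ (m + 1)) K →ₗ[R] R ⧸ spanLT y' (g + m) :=
        (topEquiv _).symm.toLinearMap ∘ₗ mulMap w (fun _ _ => trivial) (fun z _ hz => hwK z hz)
      obtain ⟨t, ht, htψ⟩ := ExtMod.exists_smul_linearMap_eq_zero hy' (fun i hi z => by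
        obtain ⟨z, rfl⟩ := Submodule.Quotient.mk_surjective _ z
        rw [← Submodule.Quotient.mk_smul]
        exact mk_eq_zero.2 (K.mul_mem_right _ (hy'K i))) hsr ψ
      have hb' : b ^ (m + 1) ∈ I ^ (m + 1) := Ideal.pow_mem_pow hbI _
      have h0 := LinearMap.congr_fun htψ (Submodule.Quotient.mk ⟨b ^ (m + 1), hb'⟩)
      have h1 : (t * (s * x - b * r)) * (w * b ^ (m + 1)) ∈ spanLT y' (g + m) :=
        (Submodule.Quotient.mk_eq_zero _).1 h0
      refine ⟨t * w, hq.isPrime.mul_notMem (fun h => ht (hqp h)) hw, ?_⟩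
      have h2 : ∀ k z, b ^ k * z ∈ K → z ∈ K := by
        intro k
        induction k with
        | zero => simp
        | succ k ih =>
          intro z hz
          rw [pow_succ', mul_assoc] at hz
          exact ih z (hbreg _ hz)
      refine h2 (m + 1) _ ?_
      have h3 := spanLT_le hy'K _ h1
      convert h3 using 1
      ring
    refine ⟨v * s, hp.mul_notMem hv hs, ?_⟩
    have h1 : v * (s * x - b * r) ∈ J := by
      refine ha.spanLT_le_left (g + m) ((hres (i := g + m) (by omega)).1 (by omega) _ ?_ hvK)
      exact I.mul_mem_left _ (I.sub_mem (I.mul_mem_left _ hx) (I.mul_mem_right _ hbI))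
    have h2 : v * s * x = v * (s * x - b * r) + b * (v * r) := by ring
    rw [h2]
    exact J.add_mem h1 (J.mul_mem_right _ (ha.mem _))
  obtain ⟨u, hu, huJ⟩ := exists_uniform hp hloc
  exact hu (hcp (mem_colon_ideal.2 huJ))

end Main

/-- **Corollary 3.2(a)** (Corso–Polini). Let `R` be a local Gorenstein ring with
infinite residue field and `I` an `R`-ideal of grade `g` satisfying `G_ℓ`, where `ℓ`
is the analytic spread of `I`, and unmixed locally in codimension `ℓ`. Suppose `I` is
weakly `(ℓ-1)`-residually `S_2` and `Ext_R^(g+j)(R/I^j, R)_p = 0` whenever `p ∈ V(I)`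
with `dim R_p ≤ ℓ` and `1 ≤ j ≤ ℓ - g`. Then the reduction number of `I` is either
zero or at least `ℓ - g + 1`. -/
theorem reduction_number_zero_or_large {R : Type u} [CommRing R] [IsLocalRing R]
    [IsNoetherianRing R] [Infinite (ResidueField R)] (hGor : IsGorensteinLocalRing R)
    (I : Ideal R) (g ℓ : ℕ) (hg : idealGrade I = (g : ℕ∞)) (hgl : g ≤ ℓ)
    (hl : analyticSpread R I = ((ℓ : ℕ∞) : WithBot ℕ∞))
    (hGs : IdealGs I ℓ)
    (hunmixed : ∀ (p : Ideal R) (hp : p.IsPrime), p ∈ associatedPrimes R (R ⧸ I) →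
      dimAt p hp ≤ (ℓ : WithBot ℕ∞) → dimAt p hp = ((g : ℕ∞) : WithBot ℕ∞))
    (hS2 : WeaklyResiduallyS2Lt I g ℓ)
    (hExt : ∀ (p : Ideal R) (hp : p.IsPrime), I ≤ p → dimAt p hp ≤ (ℓ : WithBot ℕ∞) →
      ∀ j : ℕ, 1 ≤ j → j ≤ ℓ - g → ExtVanishesAt (R ⧸ I ^ j) R (g + j) p hp) :
    reductionNumber I = 0 ∨ ℓ - g + 1 ≤ reductionNumber I := by
  by_contra! hr
  obtain ⟨hr0, hrl⟩ := hr
  have hne : {n : ℕ | ∃ J : Ideal R,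
      IsMinimalReduction J I ∧ reductionNumberWrt J I = n}.Nonempty := by
    by_contra hempty
    rw [Set.not_nonempty_iff_eq_empty] at hempty
    exact hr0 (by rw [reductionNumber, hempty, Nat.sInf_empty])
  obtain ⟨J, hJ, hJr⟩ := Nat.sInf_mem hne
  change reductionNumberWrt J I = reductionNumber I at hJr
  have hpow : I ^ (reductionNumber I + 1) = J * I ^ reductionNumber I := by
    rw [← hJr]
    exact Nat.sInf_mem (s := {r : ℕ | I ^ (r + 1) = J * I ^ r}) hJ.1.2
  have hJI : J ≠ I := by
    rintro rfl
    exact hr0 (hJr ▸ Nat.sInf_eq_zero.2 (Or.inl (by simp)))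
  obtain ⟨m, rfl⟩ : ∃ m, ℓ = g + m + 1 := ⟨ℓ - g - 1, by lia⟩
  obtain ⟨a, ha, hspan⟩ := hJ.exists_isGeneralSeq hl
  refine pow_ne_of_extLocZero hGor.1 ha hJ.1 hJI hGs hg hS2 hspan
    (fun p hp hIp hpl j hj1 hjm e => ?_) ?_
  · obtain ⟨k, hk⟩ : ∃ k, g + j = k + 1 := ⟨g + j - 1, by lia⟩
    have h := hExt p hp hIp (by rw [dimAt_eq hp]; exact_mod_cast hpl) j hj1 (by lia)
    generalize g + j = n at hk h e
    subst hk
    exact exists_extMod_smul_eq_zero p hp k h e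
  · obtain ⟨t, ht⟩ : ∃ t, m + 1 = reductionNumber I + t := ⟨m + 1 - reductionNumber I, by lia⟩
    rw [show m + 2 = reductionNumber I + 1 + t by lia, ht, pow_add, hpow, pow_add, mul_assoc]
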